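/- The function z(u) = R·θ₄(πu/ω₁ − (i ln R)/2; q)/θ₄(πu/ω₁ + (i ln R)/2; q) is holomorphic and injective on the open rectangle Q = {u ∈ ℂ : 0 < Re u < ω₁, 0 < Im u < ω₂}, and there exists γ ∈ (0, π) such that the image z(Q) equals ℂ \ ({R·e^{iφ} : |φ| ≤ γ} ∪ {(1/R)·e^{iφ} : |φ| ≤ γ} ∪ {x ∈ ℝ : x ≥ R} ∪ {x ∈ ℝ : x ≤ 1/R}); that is, z maps the rectangle conformally and univalently onto the plane with two circular slits of radii R and 1/R symmetric with respect to the real axis, connected by a slit along the real axis going through infinity. -/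

import Mathlib

open scoped Real

noncomputable section

/-- Jacobi theta function θ₁(w;q). -/
def jTheta1 (w : ℂ) (q : ℝ) : ℂ :=
  2 * ∑' n : ℕ, (-1 : ℂ) ^ n * ((q ^ (((n : ℝ) + 1 / 2) ^ 2) : ℝ) : ℂ) *
    Complex.sin (((2 * n + 1 : ℕ) : ℂ) * w)

/-- Jacobi theta function θ₂(w;q). -/
def jTheta2 (w : ℂ) (q : ℝ) : ℂ :=
  2 * ∑' n : ℕ, ((q ^ (((n : ℝ) + 1 / 2) ^ 2) : ℝ) : ℂ) *
    Complex.cos (((2 * n + 1 : ℕ) : ℂ) * w)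

/-- Jacobi theta function θ₃(w;q). -/
def jTheta3 (w : ℂ) (q : ℝ) : ℂ :=
  1 + 2 * ∑' n : ℕ, ((q ^ ((n + 1) ^ 2) : ℝ) : ℂ) *
    Complex.cos (((2 * (n + 1) : ℕ) : ℂ) * w)

/-- Jacobi theta function θ₄(w;q). -/
def jTheta4 (w : ℂ) (q : ℝ) : ℂ :=
  1 + 2 * ∑' n : ℕ, (-1 : ℂ) ^ (n + 1) * ((q ^ ((n + 1) ^ 2) : ℝ) : ℂ) *
    Complex.cos (((2 * (n + 1) : ℕ) : ℂ) * w)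

/-- The conformal map z(u) = R·θ₄(πu/ω₁ − (i ln R)/2; q)/θ₄(πu/ω₁ + (i ln R)/2; q). -/
def zmap (ω₁ R q : ℝ) (u : ℂ) : ℂ :=
  (R : ℂ) * jTheta4 ((π : ℂ) * u / (ω₁ : ℂ) - Complex.I * ((Real.log R : ℝ) : ℂ) / 2) q /
    jTheta4 ((π : ℂ) * u / (ω₁ : ℂ) + Complex.I * ((Real.log R : ℝ) : ℂ) / 2) q

end
/-! ### Finite and infinite forms of the Jacobi triple product -/

/-- The finite `q`-Pochhammer product `∏_{k=1}^{n} (1 - q^{2k})`. -/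
def evenPoch (q : ℂ) (n : ℕ) : ℂ := ∏ k ∈ Finset.range n, (1 - q ^ (2 * (k + 1)))

/-- The reciprocal of `evenPoch`, extended by zero to negative integers. -/
noncomputable def recipEvenPoch (q : ℂ) : ℤ → ℂ
  | Int.ofNat n => (evenPoch q n)⁻¹
  | Int.negSucc _ => 0

lemma recipEvenPoch_of_neg (q : ℂ) {n : ℤ} (hn : n < 0) : recipEvenPoch q n = 0 := by
  obtain ⟨m, rfl⟩ := Int.eq_negSucc_of_lt_zero hn
  rfl

lemma recipEvenPoch_natCast (q : ℂ) (n : ℕ) : recipEvenPoch q n = (evenPoch q n)⁻¹ := rfl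

lemma one_sub_pow_ne_zero_of_norm_lt_one {q : ℂ} (hq : ‖q‖ < 1) {n : ℕ} (hn : n ≠ 0) :
    1 - q ^ n ≠ 0 := by
  intro h
  have h1 : ‖q ^ n‖ = 1 := by rw [← sub_eq_zero.mp h, norm_one]
  rw [norm_pow] at h1
  exact (pow_lt_one₀ (norm_nonneg _) hq hn).ne h1

lemma evenPoch_ne_zero {q : ℂ} (hq : ‖q‖ < 1) (n : ℕ) : evenPoch q n ≠ 0 :=
  Finset.prod_ne_zero_iff.mpr fun _ _ => one_sub_pow_ne_zero_of_norm_lt_one hq (by omega)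

lemma recipEvenPoch_eq_mul_succ {q : ℂ} (hq : ‖q‖ < 1) (n : ℤ) :
    recipEvenPoch q n = (1 - q ^ (2 * (n + 1))) * recipEvenPoch q (n + 1) := by
  rcases lt_trichotomy n (-1) with h | rfl | h
  · rw [recipEvenPoch_of_neg q (by omega), recipEvenPoch_of_neg q (by omega), mul_zero]
  · simp [recipEvenPoch_of_neg]
  · obtain ⟨m, rfl⟩ := Int.eq_ofNat_of_zero_le (show 0 ≤ n by omega)
    have h1 : ((m : ℤ) + 1) = ((m + 1 : ℕ) : ℤ) := by push_cast; ring
    have h2 : (1 - q ^ (2 * (m + 1))) ≠ 0 := one_sub_pow_ne_zero_of_norm_lt_one hq (by omega)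
    have h3 := evenPoch_ne_zero hq m
    rw [h1, recipEvenPoch_natCast, recipEvenPoch_natCast, evenPoch, evenPoch,
      Finset.prod_range_succ, ← evenPoch]
    have h4 : q ^ (2 * ((m + 1 : ℕ) : ℤ)) = q ^ (2 * (m + 1)) := by
      rw [← zpow_natCast]; push_cast; rfl
    rw [h4]
    field_simp

/-- Cauchy's finite form of the Jacobi triple product. -/
theorem hasSum_finite_triple_product {q t : ℂ} (hq : ‖q‖ < 1) (hq0 : q ≠ 0) (ht : t ≠ 0) (N : ℕ) :
    HasSum (fun j : ℤ => (-1) ^ j * q ^ (j ^ 2) * t ^ j *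
        (evenPoch q (2 * N) * recipEvenPoch q (N - j) * recipEvenPoch q (N + j)))
      (∏ k ∈ Finset.range N, ((1 - q ^ (2 * k + 1) * t) * (1 - q ^ (2 * k + 1) * t⁻¹))) := by
  induction N with
  | zero =>
    convert hasSum_single (0 : ℤ) ?_ using 1
    · simp [evenPoch, recipEvenPoch]
    · intro j hj
      rcases lt_or_gt_of_ne hj with h | h
      · simp [recipEvenPoch_of_neg q h]
      · simp [recipEvenPoch_of_neg q (neg_lt_zero.mpr h)]
  | succ N ih =>
    have hl := ((Equiv.subRight (1 : ℤ)).hasSum_iff.mpr ih).mul_left (-(q ^ (2 * N + 1) * t))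
    have hr := ((Equiv.addRight (1 : ℤ)).hasSum_iff.mpr ih).mul_left (-(q ^ (2 * N + 1) * t⁻¹))
    have hm := ih.mul_left (1 + q ^ (4 * N + 2))
    convert! (hm.add hl).add hr using 1
    · ext j
      simp only [Function.comp_apply, Equiv.subRight_apply, Equiv.coe_addRight]
      have e1 : evenPoch q (2 * (N + 1)) =
          evenPoch q (2 * N) * (1 - q ^ (2 * (2 * N + 1))) * (1 - q ^ (2 * (2 * N + 2))) := by
        rw [show 2 * (N + 1) = 2 * N + 1 + 1 by ring]
        simp only [evenPoch, Finset.prod_range_succ]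
      set X : ℂ := q ^ (2 * ((N : ℤ) - j)) with hX
      set Y : ℂ := q ^ (2 * ((N : ℤ) + j)) with hY
      set U := recipEvenPoch q ((N : ℤ) + 1 - j)
      set V := recipEvenPoch q ((N : ℤ) + 1 + j)
      have hqz : ∀ m n : ℤ, q ^ (m + n) = q ^ m * q ^ n := zpow_add₀ hq0
      have qXm : q ^ (2 * ((N : ℤ) - j + 1)) = q ^ 2 * X := by
        rw [hX, mul_add, hqz, mul_comm]; norm_cast
      have qYm : q ^ (2 * ((N : ℤ) + j + 1)) = q ^ 2 * Y := by
        rw [hY, mul_add, hqz, mul_comm]; norm_cast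
      have uX : recipEvenPoch q (N - j) = (1 - q ^ 2 * X) * U := by
        rw [recipEvenPoch_eq_mul_succ hq, qXm, show (N : ℤ) - j + 1 = N + 1 - j by ring]
      have uY : recipEvenPoch q (N + j) = (1 - q ^ 2 * Y) * V := by
        rw [recipEvenPoch_eq_mul_succ hq, qYm, show (N : ℤ) + j + 1 = N + 1 + j by ring]
      have uX' : recipEvenPoch q (N - (j + 1)) = (1 - X) * ((1 - q ^ 2 * X) * U) := by
        rw [recipEvenPoch_eq_mul_succ hq, show (N : ℤ) - (j + 1) + 1 = N - j by ring, uX]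
      have uY' : recipEvenPoch q (N + (j - 1)) = (1 - Y) * ((1 - q ^ 2 * Y) * V) := by
        rw [recipEvenPoch_eq_mul_succ hq, show (N : ℤ) + (j - 1) + 1 = N + j by ring, uY]
      have uX'' : recipEvenPoch q (N - (j - 1)) = U := by
        rw [show (N : ℤ) - (j - 1) = N + 1 - j by ring]
      have uY'' : recipEvenPoch q (N + (j + 1)) = V := by
        rw [show (N : ℤ) + (j + 1) = N + 1 + j by ring]
      have hXY : q ^ (4 * N) = X * Y := by
        rw [hX, hY, ← hqz, ← zpow_natCast]; congr 1; push_cast; ring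
      have s1 : q ^ (2 * N + 1) * q ^ ((j - 1) ^ 2) = q ^ (j ^ 2) * (q ^ 2 * X) := by
        rw [← qXm, ← hqz, ← zpow_natCast, ← hqz]; congr 1; push_cast; ring
      have s2 : q ^ (2 * N + 1) * q ^ ((j + 1) ^ 2) = q ^ (j ^ 2) * (q ^ 2 * Y) := by
        rw [← qYm, ← hqz, ← zpow_natCast, ← hqz]; congr 1; push_cast; ring
      have t1 : t * t ^ (j - 1) = t ^ j := by
        rw [zpow_sub_one₀ ht]; field_simp
      have t2 : t⁻¹ * t ^ (j + 1) = t ^ j := by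
        rw [zpow_add_one₀ ht]; field_simp
      have n1 : (-1 : ℂ) ^ (j - 1) = -(-1) ^ j := by
        rw [zpow_sub_one₀ (by norm_num)]; norm_num
      have n2 : (-1 : ℂ) ^ (j + 1) = -(-1) ^ j := by
        rw [zpow_add_one₀ (by norm_num)]; norm_num
      have p1 : q ^ (2 * (2 * N + 1)) = q ^ 2 * (X * Y) := by rw [← hXY]; ring
      have p2 : q ^ (2 * (2 * N + 2)) = q ^ 4 * (X * Y) := by rw [← hXY]; ring
      have p3 : q ^ (4 * N + 2) = q ^ 2 * (X * Y) := by rw [← hXY]; ring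
      push_cast
      rw [e1, uX, uY, uX', uY', uX'', uY'', n1, n2, p1, p2, p3]
      set E := evenPoch q (2 * N)
      linear_combination (-(-1) ^ j * E * U * ((1 - Y) * ((1 - q ^ 2 * Y) * V))) *
          (t * t ^ (j - 1) * s1 + q ^ (j ^ 2) * (q ^ 2 * X) * t1) +
        (-(-1) ^ j * E * V * ((1 - X) * ((1 - q ^ 2 * X) * U))) *
          (t⁻¹ * t ^ (j + 1) * s2 + q ^ (j ^ 2) * (q ^ 2 * Y) * t2)
    · rw [Finset.prod_range_succ]
      have : q ^ (4 * N + 2) = q ^ (2 * N + 1) * q ^ (2 * N + 1) := by ring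
      rw [this]
      generalize ∏ k ∈ Finset.range N, ((1 - q ^ (2 * k + 1) * t) * (1 - q ^ (2 * k + 1) * t⁻¹)) = G
      linear_combination (G * (q ^ (2 * N + 1) * q ^ (2 * N + 1))) * mul_inv_cancel₀ ht

lemma summable_norm_pow_mul_succ {q : ℂ} (hq : ‖q‖ < 1) (c : ℂ) (a b : ℕ) (ha : a ≠ 0) :
    Summable fun k : ℕ => ‖-(q ^ (a * k + b) * c)‖ := by
  have h := (summable_geometric_of_lt_one (r := ‖q‖ ^ a) (by positivity)
    (pow_lt_one₀ (norm_nonneg _) hq ha)).mul_left (‖q‖ ^ b * ‖c‖)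
  refine h.congr fun k => ?_
  rw [norm_neg, norm_mul, norm_pow, pow_add, pow_mul]
  ring

lemma exists_tendsto_evenPoch {q : ℂ} (hq : ‖q‖ < 1) :
    ∃ P : ℂ, P ≠ 0 ∧ Filter.Tendsto (evenPoch q) Filter.atTop (nhds P) := by
  have hs := summable_norm_pow_mul_succ hq 1 2 2 two_ne_zero
  refine ⟨∏' k : ℕ, (1 + -(q ^ (2 * k + 2) * 1)), tprod_one_add_ne_zero_of_summable ?_ hs, ?_⟩
  · intro k
    rw [mul_one, ← sub_eq_add_neg]
    exact one_sub_pow_ne_zero_of_norm_lt_one hq (by omega)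
  · convert (multipliable_one_add_of_summable hs).tendsto_prod_tprod_nat using 2
    refine Finset.prod_congr rfl fun k _ => ?_
    ring

/-- The **Jacobi triple product**: partial products converge to a nonzero multiple of the
theta series. -/
theorem exists_tendsto_triple_product {q : ℂ} (hq : ‖q‖ < 1) (hq0 : q ≠ 0)
    (hs : ∀ t : ℂ, t ≠ 0 → Summable fun j : ℤ => ‖(-1) ^ j * q ^ (j ^ 2) * t ^ j‖) :
    ∃ P : ℂ, P ≠ 0 ∧ ∀ t : ℂ, t ≠ 0 → Filter.Tendsto (fun N : ℕ =>
        ∏ k ∈ Finset.range N, ((1 - q ^ (2 * k + 1) * t) * (1 - q ^ (2 * k + 1) * t⁻¹)))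
      Filter.atTop (nhds (P * ∑' j : ℤ, (-1) ^ j * q ^ (j ^ 2) * t ^ j)) := by
  obtain ⟨P, hP, hlim⟩ := exists_tendsto_evenPoch hq
  refine ⟨P⁻¹, inv_ne_zero hP, fun t ht => ?_⟩
  have hinv : Filter.Tendsto (fun n => (evenPoch q n)⁻¹) Filter.atTop (nhds P⁻¹) := hlim.inv₀ hP
  obtain ⟨C, hC⟩ := hlim.norm.bddAbove_range
  obtain ⟨D, hD⟩ := hinv.norm.bddAbove_range
  have hC' : ∀ n, ‖evenPoch q n‖ ≤ C := fun n => hC ⟨n, rfl⟩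
  have hD' : ∀ n, ‖(evenPoch q n)⁻¹‖ ≤ D := fun n => hD ⟨n, rfl⟩
  have hC0 : 0 ≤ C := (norm_nonneg _).trans (hC' 0)
  have hD0 : 0 ≤ D := (norm_nonneg _).trans (hD' 0)
  have hDz : ∀ n : ℤ, ‖recipEvenPoch q n‖ ≤ D := by
    intro n
    rcases lt_or_ge n 0 with h | h
    · simpa [recipEvenPoch_of_neg q h] using hD0
    · obtain ⟨m, rfl⟩ := Int.eq_ofNat_of_zero_le h
      exact hD' m
  have hz : Filter.Tendsto (recipEvenPoch q) Filter.atTop (nhds P⁻¹) := by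
    rw [← Nat.map_cast_int_atTop, Filter.tendsto_map'_iff]
    exact hinv
  have hN : Filter.Tendsto (fun N : ℕ => (N : ℤ)) Filter.atTop Filter.atTop :=
    tendsto_natCast_atTop_atTop
  rw [← tsum_mul_left]
  have key := tendsto_tsum_of_dominated_convergence (𝓕 := Filter.atTop)
    (f := fun (N : ℕ) (j : ℤ) => (-1) ^ j * q ^ (j ^ 2) * t ^ j *
        (evenPoch q (2 * N) * recipEvenPoch q (N - j) * recipEvenPoch q (N + j)))
    (g := fun j : ℤ => P⁻¹ * ((-1) ^ j * q ^ (j ^ 2) * t ^ j))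
    ((hs t ht).mul_right (C * D * D)) (fun j => ?_) (Filter.Eventually.of_forall fun N j => ?_)
  · exact key.congr fun N => (hasSum_finite_triple_product hq hq0 ht N).tsum_eq
  · have h1 : Filter.Tendsto (fun N : ℕ => evenPoch q (2 * N)) Filter.atTop (nhds P) :=
      hlim.comp (Filter.tendsto_id.const_mul_atTop' two_pos)
    have h2 : Filter.Tendsto (fun N : ℕ => recipEvenPoch q (N - j)) Filter.atTop (nhds P⁻¹) :=
      hz.comp (Filter.tendsto_atTop_add_const_right _ (-j) hN)
    have h3 : Filter.Tendsto (fun N : ℕ => recipEvenPoch q (N + j)) Filter.atTop (nhds P⁻¹) :=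
      hz.comp (Filter.tendsto_atTop_add_const_right _ j hN)
    convert ((h1.mul h2).mul h3).const_mul ((-1) ^ j * q ^ (j ^ 2) * t ^ j) using 2
    field_simp
  · rw [norm_mul, norm_mul (_ * recipEvenPoch _ _), norm_mul (evenPoch _ _)]
    gcongr
    exacts [hC' _, hDz _, hDz _]

lemma one_sub_mul_ne_zero_of_tendsto_zero {q t L : ℂ} (hq : ‖q‖ < 1)
    (h : ∀ k : ℕ, q ^ (2 * k + 1) * t ≠ 1 ∧ q ^ (2 * k + 1) * t⁻¹ ≠ 1)
    (hL : Filter.Tendsto (fun N : ℕ =>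
        ∏ k ∈ Finset.range N, ((1 - q ^ (2 * k + 1) * t) * (1 - q ^ (2 * k + 1) * t⁻¹)))
      Filter.atTop (nhds L)) : L ≠ 0 := by
  have h1 := summable_norm_pow_mul_succ hq t 2 1 two_ne_zero
  have h2 := summable_norm_pow_mul_succ hq t⁻¹ 2 1 two_ne_zero
  have l1 := (multipliable_one_add_of_summable h1).tendsto_prod_tprod_nat
  have l2 := (multipliable_one_add_of_summable h2).tendsto_prod_tprod_nat
  have l3 := l1.mul l2
  simp only [← Finset.prod_mul_distrib, ← sub_eq_add_neg] at l3
  rw [tendsto_nhds_unique hL l3]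
  refine mul_ne_zero ?_ ?_
  · exact tprod_one_add_ne_zero_of_summable
      (fun k => by rw [← sub_eq_add_neg, sub_ne_zero]; exact (h k).1.symm) h1
  · exact tprod_one_add_ne_zero_of_summable
      (fun k => by rw [← sub_eq_add_neg, sub_ne_zero]; exact (h k).2.symm) h2

/-! ### The function `θ₄` with nome `exp (-T)` -/

/-- The theta function `θ₄` with nome `exp (-T)`, as a function of the complex variable. -/
noncomputable def thetaFour (T : ℝ) (w : ℂ) : ℂ := jTheta4 w (Real.exp (-T))

section ThetaFour

open Complex Filter Topology

variable {T : ℝ}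

lemma jacobiTheta₂_term_eq_zpow (T : ℝ) (w : ℂ) (j : ℤ) :
    jacobiTheta₂_term j (w / π + 1 / 2) (I * T / π) =
      (-1) ^ j * (Real.exp (-T) : ℂ) ^ (j ^ 2) * exp (2 * I * w) ^ j := by
  have hpi : (π : ℂ) ≠ 0 := by exact_mod_cast Real.pi_ne_zero
  rw [jacobiTheta₂_term, ← exp_pi_mul_I, ofReal_exp, ← exp_int_mul, ← exp_int_mul, ← exp_int_mul,
    ← exp_add, ← exp_add]
  congr 1
  push_cast
  field_simp
  linear_combination (j : ℂ) ^ 2 * T * I_sq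

lemma im_I_mul_div_pi_pos (hT : 0 < T) : 0 < (I * T / π : ℂ).im := by
  rw [show (I * T / π : ℂ) = ((T / π : ℝ) : ℂ) * I by push_cast; ring, im_ofReal_mul, I_im, mul_one]
  exact div_pos hT Real.pi_pos

lemma hasSum_jacobiTheta₂_zpow (hT : 0 < T) (w : ℂ) :
    HasSum (fun j : ℤ => (-1) ^ j * (Real.exp (-T) : ℂ) ^ (j ^ 2) * exp (2 * I * w) ^ j)
      (jacobiTheta₂ (w / π + 1 / 2) (I * T / π)) :=
  (hasSum_jacobiTheta₂_term _ (im_I_mul_div_pi_pos hT)).congr_fun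
    fun j => (jacobiTheta₂_term_eq_zpow T w j).symm

lemma thetaFour_eq_jacobiTheta₂ (hT : 0 < T) (w : ℂ) :
    thetaFour T w = jacobiTheta₂ (w / π + 1 / 2) (I * T / π) := by
  have h := (hasSum_nat_add_iff' 1).mpr (hasSum_jacobiTheta₂_zpow hT w).nat_add_neg
  have h2 : HasSum (fun n : ℕ => 2 * ((-1 : ℂ) ^ (n + 1) *
      ((Real.exp (-T) ^ ((n + 1) ^ 2) : ℝ) : ℂ) * cos (((2 * (n + 1) : ℕ) : ℂ) * w)))
      (jacobiTheta₂ (w / π + 1 / 2) (I * T / π) - 1) := by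
    convert! h using 1
    · ext n
      have e1 : (-1 : ℂ) ^ (-((n + 1 : ℕ) : ℤ)) = (-1) ^ (n + 1) := by
        rw [zpow_neg, zpow_natCast, ← inv_pow]; norm_num
      have e2 : (Real.exp (-T) : ℂ) ^ (((n + 1 : ℕ) : ℤ) ^ 2) =
          (Real.exp (-T) : ℂ) ^ ((n + 1) ^ 2) := by
        rw [← zpow_natCast]; push_cast; rfl
      rw [neg_sq, e1, e2, zpow_natCast, zpow_natCast, zpow_neg, zpow_natCast, ← exp_nat_mul,
        ← exp_neg, ofReal_pow]
      have e3 := two_cos (((2 * (n + 1) : ℕ) : ℂ) * w)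
      have e4 : (((2 * (n + 1) : ℕ) : ℂ) * w) * I = ((n + 1 : ℕ) : ℂ) * (2 * I * w) := by
        push_cast; ring
      rw [neg_mul, e4] at e3
      linear_combination ((-1 : ℂ) ^ (n + 1) * (Real.exp (-T) : ℂ) ^ ((n + 1) ^ 2)) * e3
    · simp
  rw [thetaFour, jTheta4, ← tsum_mul_left, h2.tsum_eq]
  ring

lemma hasSum_thetaFour (hT : 0 < T) (w : ℂ) :
    HasSum (fun j : ℤ => (-1) ^ j * (Real.exp (-T) : ℂ) ^ (j ^ 2) * exp (2 * I * w) ^ j)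
      (thetaFour T w) :=
  thetaFour_eq_jacobiTheta₂ hT w ▸ hasSum_jacobiTheta₂_zpow hT w

lemma differentiable_thetaFour (hT : 0 < T) : Differentiable ℂ (thetaFour T) := by
  have : thetaFour T = fun w => jacobiTheta₂ (w / π + 1 / 2) (I * T / π) :=
    funext (thetaFour_eq_jacobiTheta₂ hT)
  rw [this]
  intro w
  exact (differentiableAt_jacobiTheta₂_fst _ (im_I_mul_div_pi_pos hT)).comp w (by fun_prop)

lemma thetaFour_add_pi (hT : 0 < T) (w : ℂ) : thetaFour T (w + π) = thetaFour T w := by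
  have hpi : (π : ℂ) ≠ 0 := by exact_mod_cast Real.pi_ne_zero
  rw [thetaFour_eq_jacobiTheta₂ hT, thetaFour_eq_jacobiTheta₂ hT, ← jacobiTheta₂_add_left (w / π + 1 / 2)]
  congr 1
  field_simp
  ring

lemma thetaFour_neg (T : ℝ) (w : ℂ) : thetaFour T (-w) = thetaFour T w := by
  simp only [thetaFour, jTheta4, mul_neg, cos_neg]

lemma thetaFour_conj (T : ℝ) (w : ℂ) :
    thetaFour T (starRingEnd ℂ w) = starRingEnd ℂ (thetaFour T w) := by
  simp only [thetaFour, jTheta4, map_add, map_one, map_mul, conj_tsum, map_pow, map_neg,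
    conj_ofReal, ← cos_conj, map_natCast, map_ofNat]

lemma thetaFour_add_I_mul (hT : 0 < T) (w : ℂ) :
    thetaFour T (w + I * T) = -exp (T - 2 * I * w) * thetaFour T w := by
  have hpi : (π : ℂ) ≠ 0 := by exact_mod_cast Real.pi_ne_zero
  rw [thetaFour_eq_jacobiTheta₂ hT, thetaFour_eq_jacobiTheta₂ hT,
    show (w + I * T) / π + 1 / 2 = (w / π + 1 / 2) + I * T / π by field_simp; ring,
    jacobiTheta₂_add_left']
  congr 1
  rw [show -(π : ℂ) * I * (I * T / π + 2 * (w / π + 1 / 2)) = T - 2 * I * w - π * I by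
    field_simp
    linear_combination (-T : ℂ) * I_sq, exp_sub _ (π * I), exp_pi_mul_I]
  ring

lemma norm_ofReal_exp_neg_lt_one (hT : 0 < T) : ‖(Real.exp (-T) : ℂ)‖ < 1 := by
  rw [norm_real, Real.norm_of_nonneg (Real.exp_pos _).le, Real.exp_lt_one_iff]
  linarith

lemma exists_tendsto_prod_thetaFour (hT : 0 < T) : ∃ P : ℂ, P ≠ 0 ∧ ∀ w : ℂ,
    Tendsto (fun N : ℕ => ∏ k ∈ Finset.range N,
        ((1 - (Real.exp (-T) : ℂ) ^ (2 * k + 1) * exp (2 * I * w)) *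
          (1 - (Real.exp (-T) : ℂ) ^ (2 * k + 1) * (exp (2 * I * w))⁻¹)))
      atTop (𝓝 (P * thetaFour T w)) := by
  obtain ⟨P, hP, h⟩ := exists_tendsto_triple_product (norm_ofReal_exp_neg_lt_one hT)
    (by exact_mod_cast (Real.exp_pos _).ne') (fun t ht => by
      have := (hasSum_thetaFour hT (log t / (2 * I))).summable.norm
      rwa [mul_div_cancel₀ _ (by simp), exp_log ht] at this)
  refine ⟨P, hP, fun w => ?_⟩
  have := h (exp (2 * I * w)) (exp_ne_zero _)
  rwa [(hasSum_thetaFour hT w).tsum_eq] at this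

lemma exists_of_thetaFour_eq_zero (hT : 0 < T) {w : ℂ} (hw : thetaFour T w = 0) :
    (∃ n : ℤ, w.re = n * π) ∧ ∃ m : ℤ, w.im = (m + 1 / 2) * T := by
  obtain ⟨P, hP, h⟩ := exists_tendsto_prod_thetaFour hT
  by_contra hcon
  refine one_sub_mul_ne_zero_of_tendsto_zero (norm_ofReal_exp_neg_lt_one hT) ?_ (h w)
    (by rw [hw, mul_zero])
  have key : ∀ z : ℂ, exp z = 1 → z.re = 0 ∧ ∃ n : ℤ, z.im = n * (2 * π) := by
    intro z hz
    obtain ⟨n, hn⟩ := exp_eq_one_iff.mp hz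
    exact ⟨by simp [hn], n, by simp [hn]⟩
  intro k
  rw [ofReal_exp, ← exp_nat_mul, ← exp_neg, ← exp_add, ← exp_add]
  constructor
  · intro h1
    obtain ⟨h2, n, h3⟩ := key _ h1
    simp at h2 h3
    refine hcon ⟨⟨n, by linarith⟩, ⟨-k - 1, ?_⟩⟩
    push_cast
    linarith
  · intro h1
    obtain ⟨h2, n, h3⟩ := key _ h1
    simp at h2 h3
    refine hcon ⟨⟨-n, by push_cast; linarith⟩, ⟨k, ?_⟩⟩
    push_cast
    linarith

lemma thetaFour_half_period (hT : 0 < T) : thetaFour T (I * (T / 2)) = 0 := by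
  have h := thetaFour_add_I_mul hT (-(I * (T / 2)))
  rw [show -(I * (T / 2)) + I * T = I * ((T : ℂ) / 2) by ring, thetaFour_neg,
    show (T : ℂ) - 2 * I * -(I * (T / 2)) = 0 by linear_combination (T : ℂ) * I_sq, exp_zero] at h
  linear_combination h / 2

end ThetaFour

/-! ### The slit map and its symmetries -/

/-- The map `v ↦ e^{2a} θ₄(v - ia) / θ₄(v + ia)`. -/
noncomputable def slitMap (T a : ℝ) (v : ℂ) : ℂ :=
  (Real.exp (2 * a) : ℂ) * thetaFour T (v - Complex.I * a) / thetaFour T (v + Complex.I * a)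

section SlitMap

open Complex Filter Topology Set ComplexConjugate

variable {T a : ℝ}

lemma slitMap_neg (T a : ℝ) (v : ℂ) :
    slitMap T a (-v) = (Real.exp (2 * a) : ℂ) ^ 2 * (slitMap T a v)⁻¹ := by
  have hR : (Real.exp (2 * a) : ℂ) ≠ 0 := by exact_mod_cast (Real.exp_pos _).ne'
  rw [slitMap, slitMap, show -v - I * a = -(v + I * a) by ring,
    show -v + I * a = -(v - I * a) by ring, thetaFour_neg, thetaFour_neg, inv_div]
  field_simp

lemma slitMap_conj (T a : ℝ) (v : ℂ) :
    slitMap T a (conj v) = (Real.exp (2 * a) : ℂ) ^ 2 * (conj (slitMap T a v))⁻¹ := by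
  have hR : (Real.exp (2 * a) : ℂ) ≠ 0 := by exact_mod_cast (Real.exp_pos _).ne'
  rw [slitMap, slitMap, show conj v - I * a = conj (v + I * a) by simp; ring,
    show conj v + I * a = conj (v - I * a) by simp, thetaFour_conj, thetaFour_conj, map_div₀,
    map_mul, conj_ofReal, inv_div]
  field_simp

lemma slitMap_neg_conj (T a : ℝ) (v : ℂ) : slitMap T a (-conj v) = conj (slitMap T a v) := by
  have hR : (Real.exp (2 * a) : ℂ) ≠ 0 := by exact_mod_cast (Real.exp_pos _).ne'
  rw [slitMap_neg, slitMap_conj, mul_inv, inv_inv]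
  field_simp

lemma slitMap_add_pi (hT : 0 < T) (v : ℂ) : slitMap T a (v + π) = slitMap T a v := by
  rw [slitMap, slitMap, show v + π - I * a = (v - I * a) + π by ring,
    show v + π + I * a = (v + I * a) + π by ring, thetaFour_add_pi hT, thetaFour_add_pi hT]

lemma slitMap_add_I_mul (hT : 0 < T) (v : ℂ) :
    slitMap T a (v + I * T) = ((Real.exp (2 * a) : ℂ) ^ 2)⁻¹ * slitMap T a v := by
  rw [slitMap, slitMap, show v + I * T - I * a = (v - I * a) + I * T by ring,
    show v + I * T + I * a = (v + I * a) + I * T by ring, thetaFour_add_I_mul hT,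
    thetaFour_add_I_mul hT]
  have h : exp (T - 2 * I * (v - I * a)) =
      exp (T - 2 * I * (v + I * a)) * ((Real.exp (2 * a) : ℂ) ^ 2)⁻¹ := by
    rw [ofReal_exp, ← exp_nat_mul, ← exp_neg, ← exp_add]
    congr 1
    push_cast
    linear_combination (4 * a : ℂ) * I_sq
  rw [h]
  have := exp_ne_zero (T - 2 * I * (v + I * a))
  field_simp

lemma slitMap_pi_sub_conj (hT : 0 < T) (v : ℂ) :
    slitMap T a (π - conj v) = conj (slitMap T a v) := by
  rw [show (π : ℂ) - conj v = -conj v + π by ring, slitMap_add_pi hT, slitMap_neg_conj]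

lemma slitMap_conj_add_I_mul (hT : 0 < T) (v : ℂ) :
    slitMap T a (conj v + I * T) = (conj (slitMap T a v))⁻¹ := by
  have hR : (Real.exp (2 * a) : ℂ) ≠ 0 := by exact_mod_cast (Real.exp_pos _).ne'
  rw [slitMap_add_I_mul hT, slitMap_conj]
  field_simp

lemma slitMap_im_eq_zero_of_re_eq_zero {v : ℂ} (hv : v.re = 0) : (slitMap T a v).im = 0 := by
  have h := slitMap_neg_conj T a v
  rw [show -conj v = v by apply Complex.ext <;> simp [hv]] at h
  exact conj_eq_iff_im.mp h.symm

lemma slitMap_im_eq_zero_of_re_eq_half_pi (hT : 0 < T) {v : ℂ} (hv : v.re = π / 2) :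
    (slitMap T a v).im = 0 := by
  have h := slitMap_pi_sub_conj (a := a) hT v
  rw [show (π : ℂ) - conj v = v by apply Complex.ext <;> simp [hv]; ring] at h
  exact conj_eq_iff_im.mp h.symm

/-! ### Zeros and poles -/

lemma not_exists_re_eq_int_mul_pi {x : ℝ} (h0 : 0 < x) (h1 : x < π) :
    ¬ ∃ n : ℤ, x = n * π := by
  rintro ⟨n, rfl⟩
  have h2 : (0 : ℝ) < n := pos_of_mul_pos_left h0 Real.pi_pos.le
  have h3 : (n : ℝ) < 1 := by
    by_contra! h
    nlinarith [Real.pi_pos]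
  have h4 : 0 < n := by exact_mod_cast h2
  have h5 : n < 1 := by exact_mod_cast h3
  omega

lemma eq_half_of_eq_add_half_mul {y : ℝ} (hT : 0 < T) (h0 : -(T / 2) < y) (h1 : y < 3 * T / 2)
    (h : ∃ m : ℤ, y = (m + 1 / 2) * T) : y = T / 2 := by
  obtain ⟨m, rfl⟩ := h
  have h2 : (-1 : ℝ) < m := by
    by_contra! h
    nlinarith
  have h3 : (m : ℝ) < 1 := by
    by_contra! h
    nlinarith
  have h4 : -1 < m := by exact_mod_cast h2
  have h5 : m < 1 := by exact_mod_cast h3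
  obtain rfl : m = 0 := by omega
  push_cast
  ring

lemma thetaFour_ne_zero_of_re (hT : 0 < T) {w : ℂ} (h0 : 0 < w.re) (h1 : w.re < π) :
    thetaFour T w ≠ 0 :=
  fun h => not_exists_re_eq_int_mul_pi h0 h1 (exists_of_thetaFour_eq_zero hT h).1

lemma num_ne_zero_of_re (hT : 0 < T) {v : ℂ} (h0 : 0 < v.re) (h1 : v.re < π) :
    thetaFour T (v - I * a) ≠ 0 := thetaFour_ne_zero_of_re hT (by simpa) (by simpa)

lemma den_ne_zero_of_re (hT : 0 < T) {v : ℂ} (h0 : 0 < v.re) (h1 : v.re < π) :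
    thetaFour T (v + I * a) ≠ 0 := thetaFour_ne_zero_of_re hT (by simpa) (by simpa)

lemma num_ne_zero_of_im (ha : 0 < a) (haT : 2 * a < T) {v : ℂ} (h0 : 0 ≤ v.im) (h1 : v.im ≤ T)
    (h : v.im ≠ T / 2 + a) : thetaFour T (v - I * a) ≠ 0 := by
  intro hz
  have := eq_half_of_eq_add_half_mul (y := (v - I * a).im) (by linarith) (by simp; linarith)
    (by simp; linarith) (exists_of_thetaFour_eq_zero (by linarith) hz).2
  simp at this
  exact h (by linarith)

lemma den_ne_zero_of_im (ha : 0 < a) (haT : 2 * a < T) {v : ℂ} (h0 : 0 ≤ v.im) (h1 : v.im ≤ T)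
    (h : v.im ≠ T / 2 - a) : thetaFour T (v + I * a) ≠ 0 := by
  intro hz
  have := eq_half_of_eq_add_half_mul (y := (v + I * a).im) (by linarith) (by simp; linarith)
    (by simp; linarith) (exists_of_thetaFour_eq_zero (by linarith) hz).2
  simp at this
  exact h (by linarith)

lemma slitMap_ne_zero {v : ℂ} (h1 : thetaFour T (v - I * a) ≠ 0)
    (h2 : thetaFour T (v + I * a) ≠ 0) : slitMap T a v ≠ 0 := by
  have hR : (Real.exp (2 * a) : ℂ) ≠ 0 := by exact_mod_cast (Real.exp_pos _).ne'
  exact div_ne_zero (mul_ne_zero hR h1) h2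

lemma differentiableAt_slitMap (hT : 0 < T) {v : ℂ} (h : thetaFour T (v + I * a) ≠ 0) :
    DifferentiableAt ℂ (slitMap T a) v := by
  have hd := differentiable_thetaFour hT
  unfold slitMap
  refine DifferentiableAt.div ?_ ?_ h
  · exact ((hd _).comp v (by fun_prop)).const_mul _
  · exact (hd _).comp v (by fun_prop)

lemma differentiableAt_slitMap_inv (hT : 0 < T) {v : ℂ} (h : thetaFour T (v - I * a) ≠ 0) :
    DifferentiableAt ℂ (fun v => (slitMap T a v)⁻¹) v := by
  have hd := differentiable_thetaFour hT
  have hR : (Real.exp (2 * a) : ℂ) ≠ 0 := by exact_mod_cast (Real.exp_pos _).ne'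
  simp only [slitMap, inv_div]
  refine DifferentiableAt.div ?_ ?_ (mul_ne_zero hR h)
  · exact (hd _).comp v (by fun_prop)
  · exact ((hd _).comp v (by fun_prop)).const_mul _

lemma norm_slitMap_of_im_eq_zero (ha : 0 < a) (haT : 2 * a < T) {v : ℂ} (hv : v.im = 0) :
    ‖slitMap T a v‖ = Real.exp (2 * a) := by
  have h0 : slitMap T a v ≠ 0 := slitMap_ne_zero
    (num_ne_zero_of_im ha haT hv.ge (by linarith) (by linarith))
    (den_ne_zero_of_im ha haT hv.ge (by linarith) (by linarith))
  have h := slitMap_conj T a v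
  rw [conj_eq_iff_im.mpr hv] at h
  have h2 := congrArg norm h
  rw [norm_mul, norm_inv, norm_pow, norm_conj, norm_real, Real.norm_of_nonneg (Real.exp_pos _).le]
    at h2
  have h3 : 0 < ‖slitMap T a v‖ := norm_pos_iff.mpr h0
  rw [eq_mul_inv_iff_mul_eq₀ h3.ne', ← sq] at h2
  exact (sq_eq_sq₀ h3.le (Real.exp_pos _).le).mp h2

lemma norm_slitMap_of_im_eq_half (ha : 0 < a) (haT : 2 * a < T) {v : ℂ} (hv : v.im = T / 2) :
    ‖slitMap T a v‖ = 1 := by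
  have h0 : slitMap T a v ≠ 0 := slitMap_ne_zero
    (num_ne_zero_of_im ha haT (by linarith) (by linarith) (by linarith))
    (den_ne_zero_of_im ha haT (by linarith) (by linarith) (by linarith))
  have h := slitMap_conj_add_I_mul (a := a) (show 0 < T by linarith) v
  rw [show conj v + I * T = v by apply Complex.ext <;> simp [hv]; ring] at h
  have h2 := congrArg norm h
  rw [norm_inv, norm_conj] at h2
  have h3 : 0 < ‖slitMap T a v‖ := norm_pos_iff.mpr h0
  have h4 := mul_inv_cancel₀ h3.ne'
  rw [← h2] at h4
  nlinarith

lemma slitMap_zero (ha : 0 < a) (haT : 2 * a < T) : slitMap T a 0 = Real.exp (2 * a) := by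
  have h := den_ne_zero_of_im ha haT (v := 0) (by simp) (by simp; linarith) (by simp; linarith)
  rw [slitMap, show (0 : ℂ) - I * a = -(0 + I * a) by ring, thetaFour_neg, mul_div_cancel_right₀ _ h]

lemma slitMap_half_pi (hT : 0 < T) : slitMap T a (π / 2 : ℝ) = Real.exp (2 * a) := by
  have h := den_ne_zero_of_re (a := a) hT (v := (π / 2 : ℝ)) (by simp; positivity)
    (by rw [ofReal_re]; linarith [Real.pi_pos])
  rw [slitMap, ← thetaFour_neg, ← thetaFour_add_pi hT,
    show -(((π / 2 : ℝ) : ℂ) - I * a) + π = (π / 2 : ℝ) + I * a by push_cast; ring,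
    mul_div_cancel_right₀ _ h]

lemma slitMap_inv_pole (T a : ℝ) (hT : 0 < T) : (slitMap T a (I * (T / 2 - a)))⁻¹ = 0 := by
  rw [slitMap, show I * ((T : ℂ) / 2 - a) + I * a = I * (T / 2) by ring, thetaFour_half_period hT,
    div_zero, inv_zero]

/-! ### The sign of the imaginary part -/

/-- The argument of `t - x` as a function of the real number `x`, for `t` in the upper half-plane. -/
noncomputable def argSub (t : ℂ) (x : ℝ) : ℝ := π / 2 - Real.arctan ((t.re - x) / t.im)

lemma argSub_mono {t : ℂ} (ht : 0 < t.im) : Monotone (argSub t) := by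
  intro x y hxy
  unfold argSub
  have : Real.arctan ((t.re - y) / t.im) ≤ Real.arctan ((t.re - x) / t.im) :=
    Real.arctan_strictMono.monotone (by gcongr)
  linarith

lemma argSub_pos (t : ℂ) (x : ℝ) : 0 < argSub t x := by
  have := Real.arctan_lt_pi_div_two ((t.re - x) / t.im)
  unfold argSub
  linarith

lemma argSub_lt_pi (t : ℂ) (x : ℝ) : argSub t x < π := by
  have := Real.neg_pi_div_two_lt_arctan ((t.re - x) / t.im)
  unfold argSub
  linarith

lemma exists_sub_eq_mul_exp_argSub {t : ℂ} (ht : 0 < t.im) (x : ℝ) :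
    ∃ c : ℝ, 0 < c ∧ t - x = c * exp (I * argSub t x) := by
  set y := (t.re - x) / t.im with hy
  have hs : 0 < √(1 + y ^ 2) := by positivity
  refine ⟨t.im * √(1 + y ^ 2), by positivity, ?_⟩
  rw [mul_comm I, exp_mul_I, ← ofReal_cos, ← ofReal_sin, argSub, ← hy, Real.cos_pi_div_two_sub,
    Real.sin_pi_div_two_sub, Real.cos_arctan, Real.sin_arctan]
  apply Complex.ext
  · simp
    field_simp
    rw [hy]
    field_simp
  · simp
    field_simp

lemma exists_div_eq_mul_exp_argSub {t : ℂ} (ht : 0 < t.im) (x y : ℝ) :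
    ∃ c : ℝ, 0 < c ∧ (t - x) / (t - y) = c * exp (-I * (argSub t y - argSub t x)) := by
  obtain ⟨c, hc, h1⟩ := exists_sub_eq_mul_exp_argSub ht x
  obtain ⟨d, hd, h2⟩ := exists_sub_eq_mul_exp_argSub ht y
  refine ⟨c / d, by positivity, ?_⟩
  rw [h1, h2, show -I * ((argSub t y : ℂ) - argSub t x) = I * argSub t x - I * argSub t y by ring,
    exp_sub]
  push_cast
  field_simp

/-- A finite product of quotients with interlacing zeros and poles on the real line has
non-positive imaginary part in the upper half-plane. -/
lemma im_interlacing_prod_nonpos {q R : ℝ} {t : ℂ} (hq : 0 < q) (hR : 1 < R) (hqR : q * R ≤ 1)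
    (ht : 0 < t.im) (N : ℕ) :
    ∃ S c : ℝ, 0 ≤ S ∧ S ≤ argSub t ((q ^ (2 * N))⁻¹) - argSub t (q ^ (2 * N)) ∧ 0 < c ∧
      ∏ k ∈ Finset.range N, (((1 - q ^ (2 * k + 1) * (t * R)) * (1 - q ^ (2 * k + 1) * (t * R)⁻¹)) /
        ((1 - q ^ (2 * k + 1) * (t / R)) * (1 - q ^ (2 * k + 1) * (t / R)⁻¹))) =
      c * exp (-I * S) := by
  have hR0 : 0 < R := by linarith
  have ht0 : t ≠ 0 := by
    rintro rfl
    simp at ht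
  induction N with
  | zero => exact ⟨0, 1, le_rfl, by simp, one_pos, by simp⟩
  | succ N ih =>
    obtain ⟨S, c, hS0, hS1, hc, hprod⟩ := ih
    set x := q ^ (2 * N + 1) with hx
    have hx0 : 0 < x := by positivity
    obtain ⟨d, hd, h1⟩ := exists_div_eq_mul_exp_argSub ht (x⁻¹ / R) (x⁻¹ * R)
    obtain ⟨e, he, h2⟩ := exists_div_eq_mul_exp_argSub ht (x / R) (x * R)
    have hmono := argSub_mono ht
    have m1 : argSub t (x⁻¹ / R) ≤ argSub t (x⁻¹ * R) := hmono (by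
      rw [div_le_iff₀ hR0, mul_assoc]
      exact le_mul_of_one_le_right (by positivity) (by nlinarith))
    have m2 : argSub t (x / R) ≤ argSub t (x * R) := hmono (by
      rw [div_le_iff₀ hR0, mul_assoc]
      exact le_mul_of_one_le_right (by positivity) (by nlinarith))
    have hxq : x = q ^ (2 * N) * q := by rw [hx, pow_succ]
    have hxq' : q ^ (2 * (N + 1)) = x * q := by rw [hx]; ring
    have hqRi : R ≤ q⁻¹ := by rw [le_inv_comm₀ hR0 hq, ← one_div, le_div_iff₀ hR0]; exact hqR
    have hqRi' : q ≤ R⁻¹ := by rw [← one_div, le_div_iff₀ hR0]; exact hqR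
    have m3 : argSub t (x⁻¹ * R) ≤ argSub t ((q ^ (2 * (N + 1)))⁻¹) := hmono (by
      rw [hxq', mul_inv]
      gcongr)
    have m4 : argSub t (q ^ (2 * (N + 1))) ≤ argSub t (x / R) := hmono (by
      rw [hxq', div_eq_mul_inv]
      gcongr)
    have m5 : argSub t ((q ^ (2 * N))⁻¹) ≤ argSub t (x⁻¹ / R) := hmono (by
      rw [hxq, mul_inv, mul_div_assoc]
      refine le_mul_of_one_le_right (by positivity) ?_
      rwa [le_div_iff₀ hR0, one_mul])
    have m6 : argSub t (x * R) ≤ argSub t (q ^ (2 * N)) := hmono (by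
      rw [hxq, mul_assoc]
      exact mul_le_of_le_one_right (by positivity) hqR)
    refine ⟨S + (argSub t (x⁻¹ * R) - argSub t (x⁻¹ / R)) + (argSub t (x * R) - argSub t (x / R)),
      c * (R ^ 2 * d * e), by linarith, by linarith, by positivity, ?_⟩
    rw [Finset.prod_range_succ, hprod]
    have hxc : (q : ℂ) ^ (2 * N + 1) = x := by rw [hx]; push_cast; rfl
    have hxC : (x : ℂ) ≠ 0 := by exact_mod_cast hx0.ne'
    have hRC : (R : ℂ) ≠ 0 := by exact_mod_cast hR0.ne'
    have hne : ∀ y : ℝ, t - y ≠ 0 := by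
      intro y h
      have := congrArg Complex.im h
      simp at this
      exact ht.ne' this
    have h3 := hne (x⁻¹ * R)
    have h4 := hne (x * R)
    push_cast at h1 h2 h3 h4
    have key : ((1 - (x : ℂ) * (t * R)) * (1 - x * (t * R)⁻¹)) /
        ((1 - (x : ℂ) * (t / R)) * (1 - x * (t / R)⁻¹)) =
        R ^ 2 * ((t - (x : ℂ)⁻¹ / R) / (t - (x : ℂ)⁻¹ * R)) * ((t - x / R) / (t - x * R)) := by
      have e1 : 1 - (x : ℂ) * (t * R) = -(x * R) * (t - (x : ℂ)⁻¹ / R) := by field_simp; ring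
      have e2 : 1 - (x : ℂ) * (t * R)⁻¹ = (t - x / R) / t := by field_simp
      have e3 : 1 - (x : ℂ) * (t / R) = -(x / R) * (t - (x : ℂ)⁻¹ * R) := by field_simp; ring
      have e4 : 1 - (x : ℂ) * (t / R)⁻¹ = (t - x * R) / t := by field_simp
      rw [e1, e2, e3, e4]
      generalize t - (x : ℂ)⁻¹ / R = A
      generalize t - (x : ℂ) / R = B
      generalize t - (x : ℂ)⁻¹ * R = C at *
      generalize t - (x : ℂ) * R = D at *
      field_simp
    rw [hxc, key, h1, h2]
    push_cast
    rw [mul_add, mul_add, exp_add, exp_add]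
    ring

end SlitMap

section Sign

open Complex Filter Topology Set ComplexConjugate

variable {T a : ℝ}

lemma slitMap_im_nonpos (ha : 0 < a) (haT : 2 * a < T) {v : ℂ} (h0 : 0 < v.re)
    (h1 : v.re < π / 2) : (slitMap T a v).im ≤ 0 := by
  have hT : 0 < T := by linarith
  set t : ℂ := exp (2 * I * v) with ht
  set q : ℝ := Real.exp (-T) with hq
  set R : ℝ := Real.exp (2 * a) with hR
  have htim : 0 < t.im := by
    rw [ht, exp_im]
    refine mul_pos (Real.exp_pos _) (Real.sin_pos_of_pos_of_lt_pi ?_ ?_)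
    · simp [h0]
    · simp; linarith
  have hR1 : 1 < R := by rw [hR]; exact Real.one_lt_exp_iff.mpr (by linarith)
  have hqR : q * R ≤ 1 := by
    rw [hq, hR, ← Real.exp_add]; exact Real.exp_le_one_iff.mpr (by linarith)
  have hn : exp (2 * I * (v - I * a)) = t * R := by
    rw [ht, hR, ofReal_exp, ← exp_add]
    congr 1
    push_cast
    linear_combination (-2 * a : ℂ) * I_sq
  have hd : exp (2 * I * (v + I * a)) = t / R := by
    rw [ht, hR, ofReal_exp, ← exp_sub]
    congr 1
    push_cast
    linear_combination (2 * a : ℂ) * I_sq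
  obtain ⟨P, hP, hlim⟩ := exists_tendsto_prod_thetaFour hT
  have hden : thetaFour T (v + I * a) ≠ 0 :=
    den_ne_zero_of_re hT h0 (by linarith [Real.pi_pos])
  have hratio := (hlim (v - I * a)).div (hlim (v + I * a)) (mul_ne_zero hP hden)
  rw [mul_div_mul_left _ _ hP] at hratio
  have hle : (thetaFour T (v - I * a) / thetaFour T (v + I * a)).im ≤ 0 := by
    refine le_of_tendsto ((continuous_im.tendsto _).comp hratio) (Eventually.of_forall fun N => ?_)
    obtain ⟨S, c, hS0, hS1, hc, hprod⟩ := im_interlacing_prod_nonpos (Real.exp_pos (-T)) hR1 hqR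
      htim N
    simp only [Function.comp, Pi.div_apply]
    rw [hn, hd, ← Finset.prod_div_distrib]
    rw [hprod, show -I * (S : ℂ) = ((-S : ℝ) : ℂ) * I by push_cast; ring, im_ofReal_mul,
      exp_ofReal_mul_I_im, Real.sin_neg]
    have hS := argSub_pos t (((Real.exp (-T)) ^ (2 * N)))
    have hS' := argSub_lt_pi t (((Real.exp (-T)) ^ (2 * N))⁻¹)
    have := Real.sin_nonneg_of_nonneg_of_le_pi hS0 (by linarith)
    exact mul_nonpos_of_nonneg_of_nonpos hc.le (by linarith)
  rw [slitMap, mul_div_assoc, im_ofReal_mul]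
  exact mul_nonpos_of_nonneg_of_nonpos (Real.exp_pos _).le hle

lemma isOpen_image_slitMap (ha : 0 < a) (hT : 0 < T) {s : Set ℂ} (hs : IsOpen s)
    (hs' : s ⊆ re ⁻¹' Ioo 0 π) : IsOpen (slitMap T a '' s) := by
  have hopen : IsOpen (re ⁻¹' Ioo 0 π) := isOpen_Ioo.preimage continuous_re
  have han : AnalyticOnNhd ℂ (slitMap T a) (re ⁻¹' Ioo 0 π) :=
    DifferentiableOn.analyticOnNhd (fun v hv => (differentiableAt_slitMap hT
      (den_ne_zero_of_re hT hv.1 hv.2)).differentiableWithinAt) hopen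
  have hconn : IsPreconnected (re ⁻¹' Ioo 0 π) :=
    ((convex_Ioo 0 π).linear_preimage reLm).isPreconnected
  rcases han.is_constant_or_isOpen hconn with ⟨w, hw⟩ | h
  · exfalso
    have hmem : ∀ y : ℝ, ((π / 2 : ℝ) : ℂ) + I * y ∈ re ⁻¹' Ioo 0 π := fun y => by
      simp [Real.pi_pos]
    have h1 := hw _ (hmem 0)
    have h2 := hw _ (hmem T)
    rw [ofReal_zero, mul_zero, add_zero] at h1
    rw [slitMap_add_I_mul hT, h1] at h2
    rw [slitMap_half_pi hT] at h1
    have hw0 : w ≠ 0 := by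
      rw [← h1]
      exact_mod_cast (Real.exp_pos _).ne'
    have h3 : ((Real.exp (2 * a) : ℂ) ^ 2)⁻¹ = 1 := mul_right_cancel₀ hw0 (by rw [h2, one_mul])
    rw [inv_eq_one] at h3
    have h4 : Real.exp (2 * a) ^ 2 = 1 := by exact_mod_cast h3
    have h5 : 1 < Real.exp (2 * a) := Real.one_lt_exp_iff.mpr (by linarith)
    nlinarith
  · exact h s hs' hs

lemma slitMap_im_neg (ha : 0 < a) (haT : 2 * a < T) {v : ℂ} (h0 : 0 < v.re)
    (h1 : v.re < π / 2) : (slitMap T a v).im < 0 := by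
  have hopen : IsOpen (slitMap T a '' (re ⁻¹' Ioo 0 (π / 2))) :=
    isOpen_image_slitMap ha (by linarith) (isOpen_Ioo.preimage continuous_re)
      (preimage_mono (Ioo_subset_Ioo_right (by linarith [Real.pi_pos])))
  have hsub : slitMap T a '' (re ⁻¹' Ioo 0 (π / 2)) ⊆ {w | w.im ≤ 0} := by
    rintro _ ⟨w, hw, rfl⟩
    exact slitMap_im_nonpos ha haT hw.1 hw.2
  have := interior_maximal hsub hopen (mem_image_of_mem _ (show v ∈ re ⁻¹' Ioo 0 (π / 2) from ⟨h0, h1⟩))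
  rwa [interior_setOfPred_im_le] at this

lemma slitMap_im_pos (ha : 0 < a) (haT : 2 * a < T) {v : ℂ} (h0 : π / 2 < v.re)
    (h1 : v.re < π) : 0 < (slitMap T a v).im := by
  have h := slitMap_im_neg ha haT (v := π - conj v) (by simp [h1]) (by simp; linarith)
  rw [slitMap_pi_sub_conj (by linarith), conj_im] at h
  linarith

lemma continuousOn_slitMap_inv (ha : 0 < a) (haT : 2 * a < T) :
    ContinuousOn (fun v => (slitMap T a v)⁻¹) (im ⁻¹' Icc 0 (T / 2)) := fun v hv =>
  (differentiableAt_slitMap_inv (by linarith) (num_ne_zero_of_im ha haT hv.1 (by linarith [hv.2])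
    (by linarith [hv.2]))).continuousAt.continuousWithinAt

lemma exists_norm_slitMap_inv_le (ha : 0 < a) (haT : 2 * a < T) :
    ∃ C, ∀ v : ℂ, v.im ∈ Icc 0 (T / 2) → ‖(slitMap T a v)⁻¹‖ ≤ C := by
  have hT : 0 < T := by linarith
  obtain ⟨C, hC⟩ := (isCompact_Icc.reProdIm isCompact_Icc).exists_bound_of_continuousOn
    ((continuousOn_slitMap_inv ha haT).mono
      (show Icc 0 π ×ℂ Icc 0 (T / 2) ⊆ _ from fun v hv => hv.2))
  refine ⟨C, fun v hv => ?_⟩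
  have hper : Function.Periodic (slitMap T a) π := slitMap_add_pi hT
  have := toIcoMod_mem_Ico Real.pi_pos 0 v.re
  have h := hC (v - (toIcoDiv Real.pi_pos 0 v.re : ℤ) * π) ⟨?_, by simpa using hv⟩
  · beta_reduce at h
    rwa [hper.sub_int_mul_eq] at h
  · rw [toIcoMod, zero_add] at this
    simp only [zsmul_eq_mul] at this
    simp only [sub_re, mul_re, intCast_re, ofReal_re, intCast_im, zero_mul, sub_zero, mem_preimage]
    exact ⟨this.1, this.2.le⟩

lemma norm_slitMap_inv_le_one (ha : 0 < a) (haT : 2 * a < T) {v : ℂ} (h0 : 0 ≤ v.im)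
    (h1 : v.im ≤ T / 2) : ‖(slitMap T a v)⁻¹‖ ≤ 1 := by
  have hT : 0 < T := by linarith
  have hcl : closure (im ⁻¹' Ioo 0 (T / 2)) ⊆ im ⁻¹' Icc 0 (T / 2) :=
    closure_minimal (preimage_mono Ioo_subset_Icc_self) (isClosed_Icc.preimage continuous_im)
  refine PhragmenLindelof.horizontal_strip (f := fun v => (slitMap T a v)⁻¹)
    (a := 0) (b := T / 2)
    ⟨fun w hw => ?_, (continuousOn_slitMap_inv ha haT).mono hcl⟩
    ⟨0, by rw [sub_zero]; positivity, 0, ?_⟩ ?_ ?_ h0 h1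
  · exact (differentiableAt_slitMap_inv hT (num_ne_zero_of_im ha haT hw.1.le
      (by linarith [hw.2]) (by linarith [hw.2]))).differentiableWithinAt
  · obtain ⟨C, hC⟩ := exists_norm_slitMap_inv_le ha haT
    simp only [zero_mul, Real.exp_zero]
    refine Asymptotics.IsBigO.of_bound C ?_
    refine eventually_inf_principal.mpr (Eventually.of_forall fun w hw => ?_)
    simpa using hC w (Ioo_subset_Icc_self hw)
  · intro w hw
    rw [norm_inv, norm_slitMap_of_im_eq_zero ha haT hw]
    exact inv_le_one_of_one_le₀ (Real.one_le_exp (by linarith))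
  · intro w hw
    rw [norm_inv, norm_slitMap_of_im_eq_half ha haT hw, inv_one]

lemma one_lt_norm_slitMap (ha : 0 < a) (haT : 2 * a < T) {v : ℂ} (hre : v.re ∈ Ioo 0 π)
    (h0 : 0 < v.im) (h1 : v.im < T / 2) : 1 < ‖slitMap T a v‖ := by
  have hT : 0 < T := by linarith
  have hopen : IsOpen (slitMap T a '' (Ioo 0 π ×ℂ Ioo 0 (T / 2))) :=
    isOpen_image_slitMap ha hT (isOpen_Ioo.reProdIm isOpen_Ioo) fun w hw => hw.1
  have hsub : slitMap T a '' (Ioo 0 π ×ℂ Ioo 0 (T / 2)) ⊆ (Metric.ball 0 1)ᶜ := by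
    rintro _ ⟨w, hw, rfl⟩
    have h := norm_slitMap_inv_le_one ha haT hw.2.1.le hw.2.2.le
    have hne : slitMap T a w ≠ 0 := slitMap_ne_zero (num_ne_zero_of_re hT hw.1.1 hw.1.2)
      (den_ne_zero_of_re hT hw.1.1 hw.1.2)
    rw [norm_inv, inv_le_one₀ (norm_pos_iff.mpr hne)] at h
    simpa using h
  have := interior_maximal hsub hopen (mem_image_of_mem _ ⟨hre, h0, h1⟩)
  rw [interior_compl, closure_ball _ one_ne_zero] at this
  simpa using this

lemma norm_slitMap_lt_one (ha : 0 < a) (haT : 2 * a < T) {v : ℂ} (hre : v.re ∈ Ioo 0 π)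
    (h0 : T / 2 < v.im) (h1 : v.im < T) : ‖slitMap T a v‖ < 1 := by
  have h := one_lt_norm_slitMap ha haT (v := conj v + I * T) (by simpa using hre)
    (by simp [h1]) (by simp; linarith)
  rw [slitMap_conj_add_I_mul (by linarith), norm_inv, norm_conj] at h
  by_contra! hc
  exact absurd h (not_lt.mpr (inv_le_one_of_one_le₀ hc))

end Sign

/-! ### Univalence on a quarter of the rectangle -/

section Univalence

open Complex Filter Topology Set ComplexConjugate

lemma logDeriv_re_eq_zero_of_im_eq_zero {G : ℂ → ℂ} {v : ℂ} (h : ∀ s : ℝ, (G (v + s * I)).im = 0) :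
    (logDeriv G v).re = 0 := by
  by_cases hG : DifferentiableAt ℂ G v
  · have h1 : HasDerivAt (fun s : ℝ => v + s * I) I 0 := by
      simpa using ((hasDerivAt_id (0 : ℝ)).ofReal_comp.mul_const I).const_add v
    have h2 : HasDerivAt (fun s : ℝ => G (v + s * I)) (deriv G v * I) 0 := by
      have h3 : HasDerivAt G (deriv G v) (v + (0 : ℝ) * I) := by simpa using hG.hasDerivAt
      exact h3.comp 0 h1
    have h3 : HasDerivAt (fun s : ℝ => (G (v + s * I)).im) (deriv G v * I).im 0 :=
      imCLM.hasFDerivAt.comp_hasDerivAt 0 h2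
    simp only [h] at h3
    have h4 := h3.unique (hasDerivAt_const (0 : ℝ) (0 : ℝ))
    have h5 := h 0
    simp only [mul_I_im, ofReal_zero, zero_mul, add_zero] at h4 h5
    simp [logDeriv_apply, div_re, h4, h5]
  · simp [logDeriv_apply, deriv_zero_of_not_differentiableAt hG]

lemma logDeriv_re_eq_zero_of_norm_eq {G : ℂ → ℂ} {v : ℂ} {c : ℝ}
    (h : ∀ s : ℝ, ‖G (v + s)‖ = c) : (logDeriv G v).re = 0 := by
  by_cases hG : DifferentiableAt ℂ G v
  · have h1 : HasDerivAt (fun s : ℝ => v + s) 1 0 := by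
      simpa using ((hasDerivAt_id (0 : ℝ)).ofReal_comp).const_add v
    have h2 : HasDerivAt (fun s : ℝ => G (v + s)) (deriv G v) 0 := by
      have h3 : HasDerivAt G (deriv G v) (v + (0 : ℝ)) := by simpa using hG.hasDerivAt
      simpa [Function.comp_def] using HasDerivAt.comp (h := fun s : ℝ => v + (s : ℂ)) (0 : ℝ) h3 h1
    have h3 := h2.norm_sq
    simp only [h] at h3
    have h4 := h3.unique (hasDerivAt_const (0 : ℝ) (c ^ 2))
    simp only [ofReal_zero, add_zero, Complex.inner] at h4
    simp only [logDeriv_apply, div_re]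
    simp at h4
    rw [← add_div]
    have : (deriv G v).re * (G v).re + (deriv G v).im * (G v).im = 0 := by linarith
    rw [this, zero_div]
  · simp [logDeriv_apply, deriv_zero_of_not_differentiableAt hG]

lemma exists_logDeriv_eq_div_add {G : ℂ → ℂ} {p : ℂ} (hG : AnalyticAt ℂ G p) (h0 : G p = 0)
    (hne : ¬ ∀ᶠ v in 𝓝 p, G v = 0) :
    ∃ (k : ℕ) (h : ℂ → ℂ), k ≠ 0 ∧ ContinuousAt h p ∧
      ∀ᶠ v in 𝓝[≠] p, logDeriv G v = k / (v - p) + h v := by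
  obtain ⟨k, g, hg, hgp, hev⟩ := hG.exists_eventuallyEq_pow_smul_nonzero_iff.mpr hne
  refine ⟨k, logDeriv g, ?_, ?_, ?_⟩
  · rintro rfl
    have := hev.self_of_nhds
    rw [h0, pow_zero, one_smul] at this
    exact hgp this.symm
  · exact hg.deriv.continuousAt.div hg.continuousAt hgp
  · have h1 : ∀ᶠ v in 𝓝 p, ∀ᶠ w in 𝓝 v, G w = (w - p) ^ k • g w := hev.eventually_nhds
    have h2 : ∀ᶠ v in 𝓝 p, g v ≠ 0 := hg.continuousAt.eventually_ne hgp
    have h3 : ∀ᶠ v in 𝓝 p, AnalyticAt ℂ g v := hg.eventually_analyticAt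
    filter_upwards [h1.filter_mono nhdsWithin_le_nhds, h2.filter_mono nhdsWithin_le_nhds,
      h3.filter_mono nhdsWithin_le_nhds, self_mem_nhdsWithin] with v h1 h2 h3 h4
    have hvp : v - p ≠ 0 := sub_ne_zero.mpr h4
    have h5 : logDeriv G v = logDeriv (fun w => (w - p) ^ k * g w) v := by
      have : G =ᶠ[𝓝 v] fun w => (w - p) ^ k * g w := h1
      rw [logDeriv_apply, logDeriv_apply, this.deriv_eq, this.self_of_nhds]
    rw [h5, logDeriv_mul (f := fun w => (w - p) ^ k) v (pow_ne_zero _ hvp) h2 (by fun_prop) h3.differentiableAt,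
      logDeriv_fun_pow (f := fun w => w - p) (by fun_prop)]
    simp [logDeriv_apply, div_eq_mul_inv]

variable {T a : ℝ}

/-- The reciprocal of `slitMap T a`. -/
noncomputable def slitMapInv (T a : ℝ) (v : ℂ) : ℂ := (slitMap T a v)⁻¹

lemma analyticAt_slitMapInv (hT : 0 < T) {v : ℂ} (h : thetaFour T (v - I * a) ≠ 0) :
    AnalyticAt ℂ (slitMapInv T a) v := by
  rw [analyticAt_iff_eventually_differentiableAt]
  have hc : ContinuousAt (fun v => thetaFour T (v - I * a)) v :=
    ((differentiable_thetaFour hT).continuous.comp (by fun_prop)).continuousAt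
  filter_upwards [hc.eventually_ne h] with w hw
  exact differentiableAt_slitMap_inv hT hw

lemma slitMapInv_ne_zero (ha : 0 < a) (haT : 2 * a < T) {v : ℂ} (hre : v.re ∈ Icc 0 (π / 2))
    (him : v.im ∈ Icc 0 (T / 2)) (hv : v ≠ I * (T / 2 - a)) : slitMapInv T a v ≠ 0 := by
  have hT : 0 < T := by linarith
  refine inv_ne_zero (slitMap_ne_zero (num_ne_zero_of_im ha haT him.1 (by linarith [him.2])
    (by linarith [him.2])) ?_)
  rcases hre.1.eq_or_lt with h | h
  · refine den_ne_zero_of_im ha haT him.1 (by linarith [him.2]) fun h' => hv ?_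
    apply Complex.ext <;> simp [← h, h']
  · exact den_ne_zero_of_re hT h (by linarith [hre.2, Real.pi_pos])

lemma logDeriv_slitMapInv_re_of_re_eq_zero {v : ℂ} (hv : v.re = 0) :
    (logDeriv (slitMapInv T a) v).re = 0 :=
  logDeriv_re_eq_zero_of_im_eq_zero fun s => by
    simp [slitMapInv, inv_im, slitMap_im_eq_zero_of_re_eq_zero, hv]

lemma logDeriv_slitMapInv_re_of_mem_boundary (ha : 0 < a) (haT : 2 * a < T) {v : ℂ}
    (hv : v ∈ Icc 0 (π / 2) ×ℂ Icc 0 (T / 2)) (hv' : v ∉ Ioo 0 (π / 2) ×ℂ Ioo 0 (T / 2)) :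
    (logDeriv (slitMapInv T a) v).re = 0 := by
  have hT : 0 < T := by linarith
  rcases hv.1.1.eq_or_lt with h1 | h1
  · exact logDeriv_slitMapInv_re_of_re_eq_zero h1.symm
  rcases hv.1.2.eq_or_lt with h2 | h2
  · exact logDeriv_re_eq_zero_of_im_eq_zero fun s => by
      simp [slitMapInv, inv_im, slitMap_im_eq_zero_of_re_eq_half_pi hT, h2]
  rcases hv.2.1.eq_or_lt with h3 | h3
  · exact logDeriv_re_eq_zero_of_norm_eq fun s => by
      rw [slitMapInv, norm_inv, norm_slitMap_of_im_eq_zero ha haT (by simp [← h3])]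
  rcases hv.2.2.eq_or_lt with h4 | h4
  · exact logDeriv_re_eq_zero_of_norm_eq fun s => by
      rw [slitMapInv, norm_inv, norm_slitMap_of_im_eq_half ha haT (by simp [h4])]
  exact absurd ⟨⟨h1, h2⟩, h3, h4⟩ hv'

lemma exists_logDeriv_slitMapInv_eq (ha : 0 < a) (haT : 2 * a < T) :
    ∃ (k : ℕ) (h : ℂ → ℂ), k ≠ 0 ∧ ContinuousAt h (I * (T / 2 - a)) ∧
      ∀ᶠ v in 𝓝[≠] (I * (T / 2 - a) : ℂ),
        logDeriv (slitMapInv T a) v = k / (v - I * (T / 2 - a)) + h v := by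
  have hT : 0 < T := by linarith
  refine exists_logDeriv_eq_div_add (analyticAt_slitMapInv hT (num_ne_zero_of_im ha haT ?_ ?_ ?_))
    (slitMap_inv_pole T a hT) fun hev => ?_
  · simp; linarith
  · simp; linarith
  · simp; linarith
  · have h1 : Tendsto (fun s : ℝ => I * (T / 2 - a) + (s : ℂ)) (𝓝[>] 0) (𝓝 (I * (T / 2 - a))) := by
      refine Tendsto.mono_left ?_ nhdsWithin_le_nhds
      have : Continuous (fun s : ℝ => I * (T / 2 - a) + (s : ℂ)) := by fun_prop
      simpa using this.tendsto 0
    obtain ⟨s, hs, hs1, hs2⟩ := ((h1.eventually hev).and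
      ((eventually_nhdsWithin_of_forall fun s (hs : 0 < s) => hs).and
        (nhdsWithin_le_nhds (gt_mem_nhds Real.pi_pos)))).exists
    exact inv_ne_zero (slitMap_ne_zero (num_ne_zero_of_re hT (by simpa using hs1) (by simpa using hs2))
      (den_ne_zero_of_re hT (by simpa using hs1) (by simpa using hs2))) hs

lemma exists_neg_le_logDeriv_slitMapInv_re (ha : 0 < a) (haT : 2 * a < T) {ε : ℝ} (hε : 0 < ε) :
    ∃ δ > 0, ∀ v : ℂ, dist v (I * (T / 2 - a)) < δ → v ≠ I * (T / 2 - a) → 0 ≤ v.re →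
      -ε ≤ (logDeriv (slitMapInv T a) v).re := by
  set p : ℂ := I * (T / 2 - a) with hp
  have hpre : p.re = 0 := by simp [hp]
  obtain ⟨k, h, -, hh, hev⟩ := exists_logDeriv_slitMapInv_eq ha haT
  rw [← hp] at hh hev
  have h0 : (h p).re = 0 := by
    have h1 : Tendsto (fun s : ℝ => p + s * I) (𝓝[≠] 0) (𝓝[≠] p) := by
      refine tendsto_nhdsWithin_iff.mpr ⟨Tendsto.mono_left ?_ nhdsWithin_le_nhds, ?_⟩
      · have : Continuous (fun s : ℝ => p + s * I) := by fun_prop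
        simpa using this.tendsto 0
      · exact eventually_nhdsWithin_of_forall fun s hs => by simpa using hs
    have h2 : Tendsto (fun s : ℝ => (h (p + s * I)).re) (𝓝[≠] 0) (𝓝 (h p).re) :=
      (continuous_re.tendsto _).comp (hh.tendsto.comp (h1.mono_right nhdsWithin_le_nhds))
    refine tendsto_nhds_unique h2 (tendsto_const_nhds.congr' ?_)
    filter_upwards [h1.eventually hev] with s hs
    have h3 := congrArg re hs
    rw [logDeriv_slitMapInv_re_of_re_eq_zero (by simp [hpre]), add_re] at h3
    simpa [div_re] using h3
  have h2 : ∀ᶠ v in 𝓝 p, -ε < (h v).re :=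
    ((continuous_re.continuousAt.comp hh).eventually (lt_mem_nhds (by simpa [h0] using hε)))
  obtain ⟨δ, hδ, hball⟩ := Metric.eventually_nhds_iff.mp
    (h2.and (eventually_nhdsWithin_iff.mp hev))
  refine ⟨δ, hδ, fun v hv hvp hre => ?_⟩
  obtain ⟨h3, h4⟩ := hball hv
  rw [h4 hvp, add_re, div_re]
  have : 0 ≤ (k : ℂ).re * (v - p).re / normSq (v - p) := by
    rw [natCast_re, sub_re, hpre, sub_zero]
    exact div_nonneg (mul_nonneg k.cast_nonneg hre) (normSq_nonneg _)
  simp only [natCast_im, zero_mul, zero_div, add_zero]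
  linarith

lemma analyticAt_logDeriv_slitMapInv (ha : 0 < a) (haT : 2 * a < T) {v : ℂ}
    (hv : v ∈ Icc 0 (π / 2) ×ℂ Icc 0 (T / 2)) (hvp : v ≠ I * (T / 2 - a)) :
    AnalyticAt ℂ (logDeriv (slitMapInv T a)) v := by
  have h := analyticAt_slitMapInv (a := a) (v := v) (show 0 < T by linarith)
    (num_ne_zero_of_im ha haT hv.2.1 (by linarith [hv.2.2]) (by linarith [hv.2.2]))
  exact h.deriv.div h (slitMapInv_ne_zero ha haT hv.1 hv.2 hvp)

lemma logDeriv_slitMapInv_re_nonneg (ha : 0 < a) (haT : 2 * a < T) {v : ℂ}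
    (hv : v ∈ Ioo 0 (π / 2) ×ℂ Ioo 0 (T / 2)) : 0 ≤ (logDeriv (slitMapInv T a) v).re := by
  refine le_of_forall_pos_le_add fun ε hε => ?_
  rw [← neg_le_iff_add_nonneg]
  set p : ℂ := I * (T / 2 - a) with hp
  have hvp : 0 < dist v p := dist_pos.mpr (by
    rintro rfl
    simpa [hp] using hv.1.1)
  obtain ⟨δ, hδ, hδ'⟩ := exists_neg_le_logDeriv_slitMapInv_re ha haT hε
  set r := min δ (dist v p) / 2 with hr
  have hr0 : 0 < r := by positivity
  have hrδ : r < δ := by linarith [min_le_left δ (dist v p)]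
  have hrd : r < dist v p := by linarith [min_le_right δ (dist v p)]
  set Q := Ioo 0 (π / 2) ×ℂ Ioo 0 (T / 2) with hQ
  have hQo : IsOpen Q := isOpen_Ioo.reProdIm isOpen_Ioo
  have hcl : closure (Q \ Metric.closedBall p r) ⊆
      (Icc 0 (π / 2) ×ℂ Icc 0 (T / 2)) \ Metric.ball p r := by
    refine closure_minimal ?_ ((isClosed_Icc.reProdIm isClosed_Icc).sdiff Metric.isOpen_ball)
    rintro w ⟨hw, hw'⟩
    exact ⟨⟨Ioo_subset_Icc_self hw.1, Ioo_subset_Icc_self hw.2⟩,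
      fun h => hw' (Metric.ball_subset_closedBall h)⟩
  have hne : ∀ w ∉ Metric.ball p r, w ≠ p := by
    rintro w hw rfl
    exact hw (Metric.mem_ball_self hr0)
  have hmain := norm_le_of_forall_mem_frontier_norm_le
    (f := fun w => exp (-logDeriv (slitMapInv T a) w)) (U := Q \ Metric.closedBall p r)
    (C := Real.exp ε) ?_ ?_ ?_ (subset_closure ⟨hv, by simpa using hrd⟩)
  · rw [norm_exp, Real.exp_le_exp, neg_re] at hmain
    linarith
  · exact ((Metric.isBounded_Icc _ _).reProdIm (Metric.isBounded_Icc _ _)).subset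
      (subset_closure.trans (hcl.trans sdiff_subset))
  · refine DifferentiableOn.diffContOnCl fun w hw => DifferentiableAt.differentiableWithinAt ?_
    exact (analyticAt_logDeriv_slitMapInv ha haT (hcl hw).1
      (hne w (hcl hw).2)).differentiableAt.neg.cexp
  · intro w hw
    have hw1 := hcl (frontier_subset_closure hw)
    rw [norm_exp, Real.exp_le_exp, neg_re]
    by_cases hwQ : w ∈ Q
    · have hwb : w ∈ Metric.closedBall p r := by
        by_contra hc
        have ho : IsOpen (Q \ Metric.closedBall p r) := hQo.sdiff Metric.isClosed_closedBall
        exact (ho.frontier_eq ▸ hw).2 ⟨hwQ, hc⟩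
      have := hδ' w ((Metric.mem_closedBall.mp hwb).trans_lt hrδ) (hne w hw1.2) hw1.1.1.1
      linarith
    · rw [logDeriv_slitMapInv_re_of_mem_boundary ha haT hw1.1 hwQ]
      simpa using hε.le

lemma logDeriv_slitMapInv_re_pos (ha : 0 < a) (haT : 2 * a < T) {v : ℂ}
    (hv : v ∈ Ioo 0 (π / 2) ×ℂ Ioo 0 (T / 2)) : 0 < (logDeriv (slitMapInv T a) v).re := by
  set p : ℂ := I * (T / 2 - a) with hp
  set Q := Ioo 0 (π / 2) ×ℂ Ioo 0 (T / 2) with hQ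
  have hQo : IsOpen Q := isOpen_Ioo.reProdIm isOpen_Ioo
  have han : AnalyticOnNhd ℂ (logDeriv (slitMapInv T a)) Q := fun w hw =>
    analyticAt_logDeriv_slitMapInv ha haT
      ⟨Ioo_subset_Icc_self hw.1, Ioo_subset_Icc_self hw.2⟩ (by
        rintro rfl
        simpa using hw.1.1)
  rcases han.is_constant_or_isOpen (Convex.isPreconnected
    (((convex_Ioo _ _).linear_preimage reLm).inter ((convex_Ioo _ _).linear_preimage imLm))) with
    ⟨c, hc⟩ | hopen
  · exfalso
    obtain ⟨k, h, hk, hh, hev⟩ := exists_logDeriv_slitMapInv_eq ha haT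
    rw [← hp] at hh hev
    have h1 : Tendsto (fun s : ℝ => p + (s : ℂ)) (𝓝[>] 0) (𝓝[≠] p) := by
      refine tendsto_nhdsWithin_iff.mpr ⟨Tendsto.mono_left ?_ nhdsWithin_le_nhds, ?_⟩
      · have : Continuous (fun s : ℝ => p + (s : ℂ)) := by fun_prop
        simpa using this.tendsto 0
      · exact eventually_nhdsWithin_of_forall fun s (hs : 0 < s) => by simpa using hs.ne'
    have h2 : Tendsto (fun s : ℝ => (s : ℂ) * (c - h (p + s))) (𝓝[>] 0) (𝓝 (0 * (c - h p))) := by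
      refine Tendsto.mul ?_ (tendsto_const_nhds.sub
        (hh.tendsto.comp (h1.mono_right nhdsWithin_le_nhds)))
      exact (continuous_ofReal.tendsto' 0 0 ofReal_zero).mono_left nhdsWithin_le_nhds
    have h3 : Tendsto (fun s : ℝ => (s : ℂ) * (c - h (p + s))) (𝓝[>] 0) (𝓝 k) := by
      refine tendsto_const_nhds.congr' ?_
      filter_upwards [h1.eventually hev, self_mem_nhdsWithin,
        nhdsWithin_le_nhds (gt_mem_nhds (show 0 < π / 2 by positivity))] with s hs hs1 hs2
      have hs0 : (s : ℂ) ≠ 0 := ofReal_ne_zero.mpr (ne_of_gt hs1)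
      rw [hc _ ⟨⟨by simpa [hp] using hs1, by simpa [hp] using hs2⟩, by simp [hp]; linarith,
        by simp [hp]; linarith⟩, add_sub_cancel_left] at hs
      rw [hs, add_sub_cancel_right, mul_div_cancel₀ _ hs0]
    have h4 := tendsto_nhds_unique h3 h2
    rw [zero_mul] at h4
    exact hk (by exact_mod_cast h4)
  · have hsub : logDeriv (slitMapInv T a) '' Q ⊆ {w | 0 ≤ w.re} := by
      rintro _ ⟨w, hw, rfl⟩
      exact logDeriv_slitMapInv_re_nonneg ha haT hw
    have := interior_maximal hsub (hopen Q subset_rfl hQo) (mem_image_of_mem _ hv)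
    rwa [interior_setOfPred_le_re] at this

end Univalence

/-! ### Univalence on the rectangle -/

section Injectivity

open Complex Filter Topology Set ComplexConjugate

/-- The Noshiro–Warschawski criterion for univalence on a convex domain. -/
lemma injOn_of_deriv_re_pos {U : Set ℂ} (hU : Convex ℝ U) {L L' : ℂ → ℂ}
    (hL : ∀ v ∈ U, HasDerivAt L (L' v) v) (hpos : ∀ v ∈ U, 0 < (L' v).re) : InjOn L U := by
  intro v hv w hw hvw
  by_contra hne
  set d := w - v with hd
  have hd0 : 0 < normSq d := normSq_pos.mpr (sub_ne_zero.mpr (Ne.symm hne))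
  have hmem : ∀ s ∈ Icc (0 : ℝ) 1, v + s * d ∈ U := fun s hs => by
    have := hU.add_smul_sub_mem hv hw hs
    rwa [real_smul] at this
  have hder : ∀ s ∈ Icc (0 : ℝ) 1, HasDerivAt (fun s : ℝ => (conj d * L (v + s * d)).re)
      (normSq d * (L' (v + s * d)).re) s := fun s hs => by
    have h1 : HasDerivAt (fun s : ℝ => v + s * d) d s := by
      simpa using ((hasDerivAt_id s).ofReal_comp.mul_const d).const_add v
    have h2 : HasDerivAt (fun s : ℝ => conj d * L (v + s * d)) (conj d * (L' (v + s * d) * d)) s :=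
      (HasDerivAt.comp (h := fun s : ℝ => v + s * d) s (hL _ (hmem s hs)) h1).const_mul _
    have h3 : HasDerivAt (fun s : ℝ => (conj d * L (v + s * d)).re)
        (conj d * (L' (v + s * d) * d)).re s := reCLM.hasFDerivAt.comp_hasDerivAt s h2
    rwa [show conj d * (L' (v + s * d) * d) = (normSq d : ℂ) * L' (v + s * d) by
      rw [normSq_eq_conj_mul_self]; ring, re_ofReal_mul] at h3
  obtain ⟨c, hc, hc'⟩ := exists_hasDerivAt_eq_slope (fun s : ℝ => (conj d * L (v + s * d)).re)
    (fun s => normSq d * (L' (v + s * d)).re) zero_lt_one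
    (fun s hs => (hder s hs).continuousAt.continuousWithinAt)
    (fun s hs => hder s (Ioo_subset_Icc_self hs))
  have h1 : v + (1 : ℝ) * d = w := by simp [hd]
  have h0 : v + (0 : ℝ) * d = v := by simp
  rw [h1, h0, hvw, sub_self, zero_div] at hc'
  exact (mul_pos hd0 (hpos _ (hmem c (Ioo_subset_Icc_self hc)))).ne' hc'

variable {T a : ℝ}

lemma injOn_slitMap_quarter (ha : 0 < a) (haT : 2 * a < T) :
    InjOn (slitMap T a) (Ioo 0 (π / 2) ×ℂ Ioo 0 (T / 2)) := by
  have hT : 0 < T := by linarith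
  have hpi := Real.pi_pos
  have hconv : Convex ℝ (Ioo 0 (π / 2) ×ℂ Ioo 0 (T / 2)) :=
    ((convex_Ioo _ _).linear_preimage reLm).inter ((convex_Ioo _ _).linear_preimage imLm)
  have hinj : InjOn (fun v => log (slitMapInv T a v)) (Ioo 0 (π / 2) ×ℂ Ioo 0 (T / 2)) := by
    refine injOn_of_deriv_re_pos hconv (L' := logDeriv (slitMapInv T a)) (fun v hv => ?_)
      fun v hv => logDeriv_slitMapInv_re_pos ha haT hv
    have hF : slitMap T a v ≠ 0 := slitMap_ne_zero
      (num_ne_zero_of_re hT hv.1.1 (by linarith [hv.1.2]))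
      (den_ne_zero_of_re hT hv.1.1 (by linarith [hv.1.2]))
    refine HasDerivAt.clog (DifferentiableAt.hasDerivAt ?_) ?_
    · exact differentiableAt_slitMap_inv hT (num_ne_zero_of_re hT hv.1.1 (by linarith [hv.1.2]))
    · refine mem_slitPlane_iff.mpr (Or.inr ?_)
      rw [slitMapInv, inv_im]
      exact div_ne_zero (neg_ne_zero.mpr (slitMap_im_neg ha haT hv.1.1 hv.1.2).ne)
        (normSq_pos.mpr hF).ne'
  exact fun v hv w hw h => hinj hv hw (by simp only [slitMapInv, h])

lemma eq_of_slitMap_eq_of_re_lt (ha : 0 < a) (haT : 2 * a < T) {v w : ℂ}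
    (hv : v ∈ Ioo 0 (π / 2) ×ℂ Ioo 0 T) (hw : w ∈ Ioo 0 (π / 2) ×ℂ Ioo 0 T) (hv' : v.im ≠ T / 2)
    (hw' : w.im ≠ T / 2) (h : slitMap T a v = slitMap T a w) : v = w := by
  have hT : 0 < T := by linarith
  have hpi := Real.pi_pos
  have hvre : v.re ∈ Ioo 0 π := ⟨hv.1.1, by linarith [hv.1.2]⟩
  have hwre : w.re ∈ Ioo 0 π := ⟨hw.1.1, by linarith [hw.1.2]⟩
  rcases lt_or_gt_of_ne hv' with h1 | h1 <;> rcases lt_or_gt_of_ne hw' with h2 | h2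
  · exact injOn_slitMap_quarter ha haT ⟨hv.1, hv.2.1, h1⟩ ⟨hw.1, hw.2.1, h2⟩ h
  · have h3 := one_lt_norm_slitMap ha haT hvre hv.2.1 h1
    have h4 := norm_slitMap_lt_one ha haT hwre h2 hw.2.2
    rw [h] at h3
    linarith
  · have h3 := one_lt_norm_slitMap ha haT hwre hw.2.1 h2
    have h4 := norm_slitMap_lt_one ha haT hvre h1 hv.2.2
    rw [h] at h4
    linarith
  · have h3 : conj v + I * T = conj w + I * T := by
      refine injOn_slitMap_quarter ha haT ⟨by simpa using hv.1, ?_⟩ ⟨by simpa using hw.1, ?_⟩ ?_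
      · simpa using ⟨hv.2.2, by linarith⟩
      · simpa using ⟨hw.2.2, by linarith⟩
      · rw [slitMap_conj_add_I_mul hT, slitMap_conj_add_I_mul hT, h]
    exact (starRingEnd ℂ).injective (add_right_cancel h3)

lemma eq_of_slitMap_eq_of_ne (ha : 0 < a) (haT : 2 * a < T) {v w : ℂ}
    (hv : v ∈ Ioo 0 π ×ℂ Ioo 0 T) (hw : w ∈ Ioo 0 π ×ℂ Ioo 0 T) (hv' : v.re ≠ π / 2)
    (hw' : w.re ≠ π / 2) (hvi : v.im ≠ T / 2) (hwi : w.im ≠ T / 2)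
    (h : slitMap T a v = slitMap T a w) : v = w := by
  have hT : 0 < T := by linarith
  rcases lt_or_gt_of_ne hv' with h1 | h1 <;> rcases lt_or_gt_of_ne hw' with h2 | h2
  · exact eq_of_slitMap_eq_of_re_lt ha haT ⟨⟨hv.1.1, h1⟩, hv.2⟩ ⟨⟨hw.1.1, h2⟩, hw.2⟩ hvi hwi h
  · have h3 := slitMap_im_neg ha haT hv.1.1 h1
    have h4 := slitMap_im_pos ha haT h2 hw.1.2
    rw [h] at h3
    linarith
  · have h3 := slitMap_im_neg ha haT hw.1.1 h2
    have h4 := slitMap_im_pos ha haT h1 hv.1.2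
    rw [h] at h4
    linarith
  · have h3 : (π : ℂ) - conj v = π - conj w := by
      refine eq_of_slitMap_eq_of_re_lt ha haT (v := π - conj v) (w := π - conj w)
        ⟨?_, by simpa using hv.2⟩ ⟨?_, by simpa using hw.2⟩ (by simpa using hvi)
        (by simpa using hwi) ?_
      · simp only [mem_preimage, sub_re, ofReal_re, conj_re]
        exact ⟨by linarith [hv.1.2], by linarith⟩
      · simp only [mem_preimage, sub_re, ofReal_re, conj_re]
        exact ⟨by linarith [hw.1.2], by linarith⟩
      · rw [slitMap_pi_sub_conj hT, slitMap_pi_sub_conj hT, h]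
    exact (starRingEnd ℂ).injective (sub_right_injective h3)

lemma mem_nhds_image_slitMap (ha : 0 < a) (hT : 0 < T) {s : Set ℂ} (hs : IsOpen s) {v : ℂ}
    (hv : v ∈ Ioo 0 π ×ℂ Ioo 0 T) (hvs : v ∈ s) :
    slitMap T a '' (s ∩ Ioo 0 π ×ℂ Ioo 0 T) ∈ 𝓝 (slitMap T a v) :=
  (isOpen_image_slitMap ha hT (hs.inter (isOpen_Ioo.reProdIm isOpen_Ioo))
    fun _ hw => hw.2.1).mem_nhds (mem_image_of_mem _ ⟨hvs, hv⟩)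

lemma injOn_slitMap (ha : 0 < a) (haT : 2 * a < T) :
    InjOn (slitMap T a) (Ioo 0 π ×ℂ Ioo 0 T) := by
  intro v hv w hw h
  by_contra hne
  have hT : 0 < T := by linarith
  obtain ⟨N₁, N₂, hN₁, hN₂, hv1, hw2, hdisj⟩ := t2_separation hne
  have hcont : ContinuousAt (slitMap T a) v :=
    (differentiableAt_slitMap hT (den_ne_zero_of_re hT hv.1.1 hv.1.2)).continuousAt
  have hmem : ∀ᶠ z in 𝓝 v, (z ∈ N₁ ∧ z ∈ Ioo 0 π ×ℂ Ioo 0 T) ∧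
      slitMap T a z ∈ slitMap T a '' (N₂ ∩ Ioo 0 π ×ℂ Ioo 0 T) :=
    ((hN₁.eventually_mem hv1).and
      ((isOpen_Ioo.reProdIm isOpen_Ioo).eventually_mem hv)).and
      (hcont.eventually (h ▸ mem_nhds_image_slitMap ha hT hN₂ hw hw2))
  have hlim : Tendsto (fun s : ℝ => v + (s + s * I)) (𝓝[>] 0) (𝓝 v) := by
    have : Continuous (fun s : ℝ => v + (s + s * I)) := by fun_prop
    exact (this.tendsto' 0 v (by simp)).mono_left nhdsWithin_le_nhds
  have hgen : ∀ x c : ℝ, ∀ᶠ s in 𝓝[>] (0 : ℝ), x + s ≠ c := fun x c => by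
    rcases eq_or_ne x c with rfl | hx
    · exact eventually_nhdsWithin_of_forall fun s (hs : 0 < s) => by linarith
    · have : ContinuousAt (fun s : ℝ => x + s) 0 := by fun_prop
      exact nhdsWithin_le_nhds (this.eventually_ne (by simpa using hx))
  obtain ⟨s, ⟨⟨hs1, hsQ⟩, z, ⟨hz2, hzQ⟩, hz⟩, hsre, hsim⟩ := ((hlim.eventually hmem).and
    ((hgen v.re (π / 2)).and (hgen v.im (T / 2)))).exists
  set y : ℂ := v + (s + s * I) with hy
  have hyre : y.re ≠ π / 2 := by simpa [hy] using hsre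
  have hyim : y.im ≠ T / 2 := by simpa [hy] using hsim
  have h1 : (slitMap T a y).im ≠ 0 := by
    rcases lt_or_gt_of_ne hyre with h | h
    · exact (slitMap_im_neg ha haT hsQ.1.1 h).ne
    · exact (slitMap_im_pos ha haT h hsQ.1.2).ne'
  have h2 : ‖slitMap T a y‖ ≠ 1 := by
    rcases lt_or_gt_of_ne hyim with h | h
    · exact (one_lt_norm_slitMap ha haT hsQ.1 hsQ.2.1 h).ne'
    · exact (norm_slitMap_lt_one ha haT hsQ.1 h hsQ.2.2).ne
  have h3 := eq_of_slitMap_eq_of_ne ha haT hsQ hzQ hyre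
    (fun h => h1 (hz ▸ slitMap_im_eq_zero_of_re_eq_half_pi hT h)) hyim
    (fun h => h2 (hz ▸ norm_slitMap_of_im_eq_half ha haT h)) hz.symm
  exact disjoint_left.mp hdisj hs1 (h3 ▸ hz2)

lemma slitMap_ne_of_mem_boundary (ha : 0 < a) (haT : 2 * a < T) {b v : ℂ}
    (hb : b ∈ Icc 0 π ×ℂ Icc 0 T) (hb' : b ∉ Ioo 0 π ×ℂ Ioo 0 T)
    (hden : thetaFour T (b + I * a) ≠ 0) (hv : v ∈ Ioo 0 π ×ℂ Ioo 0 T) :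
    slitMap T a b ≠ slitMap T a v := by
  intro h
  have hT : 0 < T := by linarith
  obtain ⟨N₁, N₂, hN₁, hN₂, hb1, hv2, hdisj⟩ := t2_separation (ne_of_mem_of_not_mem hv hb').symm
  have hmem : ∀ᶠ z in 𝓝 b, z ∈ N₁ ∧ slitMap T a z ∈ slitMap T a '' (N₂ ∩ Ioo 0 π ×ℂ Ioo 0 T) :=
    (hN₁.eventually_mem hb1).and ((differentiableAt_slitMap hT hden).continuousAt.eventually
      (h ▸ mem_nhds_image_slitMap ha hT hN₂ hv hv2))
  have hcl : b ∈ closure (Ioo 0 π ×ℂ Ioo 0 T) := by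
    rwa [closure_reProdIm, closure_Ioo Real.pi_pos.ne, closure_Ioo hT.ne]
  obtain ⟨y, ⟨hy1, z, ⟨hz2, hzQ⟩, hz⟩, hyQ⟩ := mem_closure_iff_nhds.mp hcl _ hmem
  exact disjoint_left.mp hdisj hy1 (injOn_slitMap ha haT hzQ hyQ hz ▸ hz2)

end Injectivity

/-! ### Boundary values -/

section Boundary

open Complex Filter Topology Set ComplexConjugate

variable {T a : ℝ}

/-- Two circular arcs of radii `R` and `R⁻¹` joined by a slit along the real axis through infinity. -/
def slitSet (R γ : ℝ) : Set ℂ :=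
  {w : ℂ | ∃ φ : ℝ, |φ| ≤ γ ∧ w = (R : ℂ) * Complex.exp (Complex.I * (φ : ℂ))} ∪
    {w : ℂ | ∃ φ : ℝ, |φ| ≤ γ ∧ w = (R : ℂ)⁻¹ * Complex.exp (Complex.I * (φ : ℂ))} ∪
    {w : ℂ | ∃ x : ℝ, w = (x : ℂ) ∧ R ≤ x} ∪
    {w : ℂ | ∃ x : ℝ, w = (x : ℂ) ∧ x ≤ 1 / R}

lemma continuousAt_slitMap_ofReal (ha : 0 < a) (haT : 2 * a < T) (x : ℝ) :
    ContinuousAt (fun x : ℝ => slitMap T a x) x := by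
  have h := (differentiableAt_slitMap (a := a) (v := (x : ℂ)) (show 0 < T by linarith)
    (den_ne_zero_of_im ha haT (by simp) (by simp; linarith) (by simp; linarith))).continuousAt
  exact h.comp continuous_ofReal.continuousAt

lemma slitMap_ofReal_eq (ha : 0 < a) (haT : 2 * a < T) (x : ℝ) :
    slitMap T a x = (Real.exp (2 * a) : ℂ) * exp (I * (arg (slitMap T a x) : ℂ)) := by
  conv_lhs => rw [← norm_mul_exp_arg_mul_I (slitMap T a x),
    norm_slitMap_of_im_eq_zero ha haT (ofReal_im x), mul_comm _ I]

lemma exists_arc_slitMap (ha : 0 < a) (haT : 2 * a < T) :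
    ∃ γ : ℝ, 0 < γ ∧ γ < π ∧ ∀ w : ℂ, (∃ x : ℝ, x ∈ Icc 0 π ∧ slitMap T a x = w) ↔
      ∃ φ : ℝ, |φ| ≤ γ ∧ w = (Real.exp (2 * a) : ℂ) * exp (I * (φ : ℂ)) := by
  have hT : 0 < T := by linarith
  have hpi := Real.pi_pos
  set θ : ℝ → ℝ := fun x => arg (slitMap T a x) with hθ
  have h0 : slitMap T a ((0 : ℝ) : ℂ) = Real.exp (2 * a) := by
    rw [ofReal_zero, slitMap_zero ha haT]
  have hθ0 : θ 0 = 0 := by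
    simp only [hθ, h0]
    exact arg_ofReal_of_nonneg (Real.exp_pos _).le
  have hθ1 : θ (π / 2) = 0 := by
    simp only [hθ, slitMap_half_pi hT]
    exact arg_ofReal_of_nonneg (Real.exp_pos _).le
  have hneg : ∀ x ∈ Ioo 0 (π / 2), (slitMap T a x).im < 0 := fun x hx =>
    slitMap_im_neg ha haT (by simpa using hx.1) (by simpa using hx.2)
  have hslit : ∀ x ∈ Icc 0 (π / 2), slitMap T a x ∈ slitPlane := fun x hx => by
    rcases hx.1.eq_or_lt with rfl | h1
    · rw [h0]
      exact ofReal_mem_slitPlane.mpr (Real.exp_pos _)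
    rcases hx.2.eq_or_lt with rfl | h2
    · rw [slitMap_half_pi hT]
      exact ofReal_mem_slitPlane.mpr (Real.exp_pos _)
    exact mem_slitPlane_iff.mpr (Or.inr (hneg x ⟨h1, h2⟩).ne)
  have hcont : ContinuousOn θ (Icc 0 (π / 2)) := fun x hx =>
    (ContinuousAt.comp (f := fun x : ℝ => slitMap T a x) (continuousAt_arg (hslit x hx))
      (continuousAt_slitMap_ofReal ha haT x)).continuousWithinAt
  have hle : ∀ x ∈ Icc 0 (π / 2), θ x ≤ 0 := fun x hx => by
    rcases hx.1.eq_or_lt with rfl | h1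
    · exact hθ0.le
    rcases hx.2.eq_or_lt with rfl | h2
    · exact hθ1.le
    exact (arg_neg_iff.mpr (hneg x ⟨h1, h2⟩)).le
  obtain ⟨x₀, hx₀, hmin⟩ := isCompact_Icc.exists_isMinOn
    (nonempty_Icc.mpr (show 0 ≤ π / 2 by positivity)) hcont
  have hmem : ∀ x ∈ Icc 0 (π / 2), |θ x| ≤ -θ x₀ := fun x hx => by
    rw [abs_of_nonpos (hle x hx)]
    exact neg_le_neg (hmin hx)
  refine ⟨-θ x₀, ?_, ?_, fun w => ⟨?_, ?_⟩⟩
  · have h4 : π / 4 ∈ Ioo 0 (π / 2) := ⟨by positivity, by linarith⟩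
    have h5 : θ x₀ ≤ θ (π / 4) := hmin (Ioo_subset_Icc_self h4)
    have h6 : θ (π / 4) < 0 := arg_neg_iff.mpr (hneg _ h4)
    linarith
  · linarith [neg_pi_lt_arg (slitMap T a x₀)]
  · rintro ⟨x, hx, rfl⟩
    rcases le_total x (π / 2) with h | h
    · exact ⟨θ x, hmem x ⟨hx.1, h⟩, slitMap_ofReal_eq ha haT x⟩
    · refine ⟨-θ (π - x), by rw [abs_neg]; exact hmem _ ⟨by linarith [hx.2], by linarith⟩, ?_⟩
      have h1 := slitMap_pi_sub_conj (a := a) hT ((π - x : ℝ) : ℂ)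
      rw [conj_ofReal, show (π : ℂ) - ((π - x : ℝ) : ℂ) = x by push_cast; ring,
        slitMap_ofReal_eq ha haT (π - x), map_mul, conj_ofReal, ← exp_conj, map_mul, conj_I,
        conj_ofReal] at h1
      rw [h1, ofReal_neg, mul_neg, neg_mul]
  · rintro ⟨φ, hφ, rfl⟩
    have himage : Icc (θ x₀) 0 ⊆ θ '' Icc 0 x₀ := by
      have := intermediate_value_Icc' hx₀.1 (hcont.mono (Icc_subset_Icc_right hx₀.2))
      rwa [hθ0] at this
    obtain ⟨h1, h2⟩ := abs_le.mp hφ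
    rcases le_total φ 0 with h | h
    · obtain ⟨x, hx, rfl⟩ := himage ⟨by linarith, h⟩
      exact ⟨x, ⟨hx.1, by linarith [hx.2, hx₀.2]⟩, slitMap_ofReal_eq ha haT x⟩
    · obtain ⟨x, hx, hx'⟩ := himage ⟨by linarith, neg_nonpos.mpr h⟩
      refine ⟨π - x, ⟨by linarith [hx.2, hx₀.2], by linarith [hx.1]⟩, ?_⟩
      have h1 := slitMap_pi_sub_conj (a := a) hT (x : ℂ)
      rw [conj_ofReal, slitMap_ofReal_eq ha haT x, map_mul, conj_ofReal, ← exp_conj, map_mul,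
        conj_I, conj_ofReal, show arg (slitMap T a x) = -φ from hx'] at h1
      rw [ofReal_sub, h1]
      push_cast
      ring_nf

lemma exists_slitMap_midline_eq (ha : 0 < a) (haT : 2 * a < T) {r : ℝ}
    (hr : r ∈ Ioo (Real.exp (2 * a))⁻¹ (Real.exp (2 * a))) :
    ∃ v ∈ Ioo 0 π ×ℂ Ioo 0 T, slitMap T a v = r := by
  have hT : 0 < T := by linarith
  have hpi := Real.pi_pos
  set f : ℝ → ℂ := fun y => slitMap T a ((π / 2 : ℝ) + I * y) with hf
  have hre : ∀ y : ℝ, (((π / 2 : ℝ) : ℂ) + I * y).re = π / 2 := fun y => by simp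
  have hcont : Continuous fun y => (f y).re := by
    refine continuous_re.comp (continuous_iff_continuousAt.mpr fun y => ?_)
    refine ContinuousAt.comp (f := fun y : ℝ => ((π / 2 : ℝ) : ℂ) + I * y)
      (differentiableAt_slitMap hT (den_ne_zero_of_re hT ?_ ?_)).continuousAt (by fun_prop)
    · rw [hre]; positivity
    · rw [hre]; linarith
  have h0 : (f 0).re = Real.exp (2 * a) := by
    simp only [hf, ofReal_zero, mul_zero, add_zero, slitMap_half_pi hT, ofReal_re]
  have h1 : (f T).re = (Real.exp (2 * a))⁻¹ := by
    simp only [hf]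
    rw [slitMap_add_I_mul hT, slitMap_half_pi hT, ← ofReal_pow, ← ofReal_inv, ← ofReal_mul, ofReal_re]
    field_simp
  have himage := intermediate_value_Ioo' hT.le hcont.continuousOn
  rw [h0, h1] at himage
  obtain ⟨y, hy, rfl⟩ := himage hr
  refine ⟨(π / 2 : ℝ) + I * y, ⟨?_, by simpa using hy⟩, ?_⟩
  · rw [mem_preimage, hre]
    exact ⟨by positivity, by linarith⟩
  · exact Complex.ext rfl (slitMap_im_eq_zero_of_re_eq_half_pi hT (hre y))

lemma slitMap_mem_slitSet_of_re_eq_zero (ha : 0 < a) (haT : 2 * a < T) (γ : ℝ) {b : ℂ}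
    (hre : b.re = 0) (him : b.im ∈ Icc 0 T) :
    slitMap T a b ∈ slitSet (Real.exp (2 * a)) γ := by
  have hreal : slitMap T a b = ((slitMap T a b).re : ℝ) :=
    Complex.ext rfl (slitMap_im_eq_zero_of_re_eq_zero hre)
  by_cases h1 : Real.exp (2 * a) ≤ (slitMap T a b).re
  · exact Or.inl (Or.inr ⟨_, hreal, h1⟩)
  by_cases h2 : (slitMap T a b).re ≤ 1 / Real.exp (2 * a)
  · exact Or.inr ⟨_, hreal, h2⟩
  exfalso
  have hden : thetaFour T (b + I * a) ≠ 0 := fun h => h2 (by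
    rw [slitMap, h, div_zero]
    simp [(Real.exp_pos _).le])
  obtain ⟨v, hv, hvb⟩ := exists_slitMap_midline_eq ha haT (r := (slitMap T a b).re)
    ⟨by rw [← one_div]; exact not_le.mp h2, not_le.mp h1⟩
  refine slitMap_ne_of_mem_boundary ha haT ⟨?_, him⟩ (fun h => ?_) hden hv (hreal.trans hvb.symm)
  · rw [mem_preimage, hre]
    exact left_mem_Icc.mpr Real.pi_pos.le
  · have := h.1.1
    rw [hre] at this
    exact lt_irrefl _ this

lemma slitMap_mem_slitSet (ha : 0 < a) (haT : 2 * a < T) {γ : ℝ}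
    (hγ : ∀ w : ℂ, (∃ x : ℝ, x ∈ Icc 0 π ∧ slitMap T a x = w) ↔
      ∃ φ : ℝ, |φ| ≤ γ ∧ w = (Real.exp (2 * a) : ℂ) * exp (I * (φ : ℂ)))
    {b : ℂ} (hb : b ∈ Icc 0 π ×ℂ Icc 0 T) (hb' : b ∉ Ioo 0 π ×ℂ Ioo 0 T) :
    slitMap T a b ∈ slitSet (Real.exp (2 * a)) γ := by
  have hT : 0 < T := by linarith
  have hR : (Real.exp (2 * a) : ℂ) ≠ 0 := ofReal_ne_zero.mpr (Real.exp_pos _).ne'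
  rcases hb.1.1.eq_or_lt with h1 | h1
  · exact slitMap_mem_slitSet_of_re_eq_zero ha haT γ h1.symm hb.2
  rcases hb.1.2.eq_or_lt with h2 | h2
  · rw [show b = (b - π) + π by ring, slitMap_add_pi hT]
    exact slitMap_mem_slitSet_of_re_eq_zero ha haT γ (by simp [h2]) (by simpa using hb.2)
  rcases hb.2.1.eq_or_lt with h3 | h3
  · refine Or.inl (Or.inl (Or.inl ((hγ _).mp ⟨b.re, hb.1, ?_⟩)))
    congr 1
    exact Complex.ext (ofReal_re _) (by rw [ofReal_im, h3])
  rcases hb.2.2.eq_or_lt with h4 | h4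
  · refine Or.inl (Or.inl (Or.inr ?_))
    obtain ⟨φ, hφ, h5⟩ := (hγ _).mp ⟨b.re, hb.1, rfl⟩
    refine ⟨φ, hφ, ?_⟩
    rw [show b = b.re + I * T by apply Complex.ext <;> simp [h4], slitMap_add_I_mul hT, h5]
    field_simp
  exact absurd ⟨⟨h1, h2⟩, h3, h4⟩ hb'

lemma slitMap_I_mul_half (ha : 0 < a) (haT : 2 * a < T) : slitMap T a (I * (T / 2 : ℝ)) = -1 := by
  have hT : 0 < T := by linarith
  have h1 : ‖slitMap T a (I * (T / 2 : ℝ))‖ = 1 := norm_slitMap_of_im_eq_half ha haT (by simp)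
  have hreal : slitMap T a (I * (T / 2 : ℝ)) = ((slitMap T a (I * (T / 2 : ℝ))).re : ℝ) :=
    Complex.ext rfl (slitMap_im_eq_zero_of_re_eq_zero (by simp))
  rw [hreal, norm_real, Real.norm_eq_abs] at h1
  have hone : 1 < Real.exp (2 * a) := Real.one_lt_exp_iff.mpr (by linarith)
  rcases eq_or_eq_neg_of_abs_eq h1 with h | h
  · exfalso
    obtain ⟨v, hv, hv'⟩ := exists_slitMap_midline_eq ha haT (r := 1)
      ⟨inv_lt_one_of_one_lt₀ hone, hone⟩
    refine slitMap_ne_of_mem_boundary ha haT (b := I * (T / 2 : ℝ)) ⟨?_, ?_⟩ (fun hc => ?_)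
      (den_ne_zero_of_im ha haT ?_ ?_ ?_) hv (by rw [hreal, h, hv'])
    · simp [Real.pi_pos.le]
    · simp; constructor <;> linarith
    · simpa using hc.1.1
    · simp; linarith
    · simp; linarith
    · simp; linarith
  · rw [hreal, h]
    simp

lemma exists_slitMap_inv_eq (ha : 0 < a) (haT : 2 * a < T) {s : ℝ}
    (hs : s ∈ Icc (-1) (Real.exp (2 * a))⁻¹) :
    ∃ y ∈ Icc 0 (T / 2), (slitMap T a (I * y))⁻¹ = s := by
  have hT : 0 < T := by linarith
  have hcont : ContinuousOn (fun y : ℝ => ((slitMap T a (I * y))⁻¹).re) (Icc 0 (T / 2)) := by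
    refine continuous_re.comp_continuousOn ((continuousOn_slitMap_inv ha haT).comp
      (f := fun y : ℝ => I * (y : ℂ)) (by fun_prop) fun y hy => ?_)
    simpa using hy
  have himage := intermediate_value_Icc' (by positivity) hcont
  rw [slitMap_I_mul_half ha haT, ofReal_zero, mul_zero, slitMap_zero ha haT, ← ofReal_inv, ofReal_re,
    inv_neg, inv_one, neg_re, one_re] at himage
  obtain ⟨y, hy, rfl⟩ := himage hs
  refine ⟨y, hy, Complex.ext rfl ?_⟩
  rw [inv_im, slitMap_im_eq_zero_of_re_eq_zero (by simp), neg_zero, zero_div, ofReal_im]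

lemma exists_boundary_slitMap_eq (ha : 0 < a) (haT : 2 * a < T) {γ : ℝ}
    (hγ : ∀ w : ℂ, (∃ x : ℝ, x ∈ Icc 0 π ∧ slitMap T a x = w) ↔
      ∃ φ : ℝ, |φ| ≤ γ ∧ w = (Real.exp (2 * a) : ℂ) * exp (I * (φ : ℂ)))
    {w : ℂ} (hw : w ∈ slitSet (Real.exp (2 * a)) γ) :
    ∃ b ∈ Icc 0 π ×ℂ Icc 0 T, b ∉ Ioo 0 π ×ℂ Ioo 0 T ∧ thetaFour T (b + I * a) ≠ 0 ∧
      slitMap T a b = w := by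
  have hT : 0 < T := by linarith
  have hpi := Real.pi_pos
  have hR : (Real.exp (2 * a) : ℂ) ≠ 0 := ofReal_ne_zero.mpr (Real.exp_pos _).ne'
  have hone : 1 < Real.exp (2 * a) := Real.one_lt_exp_iff.mpr (by linarith)
  have hlow : ∀ x : ℝ, x ∈ Icc (-1) (Real.exp (2 * a))⁻¹ → x ≠ 0 →
      ∃ b ∈ Icc 0 π ×ℂ Icc 0 T, b ∉ Ioo 0 π ×ℂ Ioo 0 T ∧ thetaFour T (b + I * a) ≠ 0 ∧
        slitMap T a b = (x : ℂ)⁻¹ := fun x hx hx0 => by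
    obtain ⟨y, hy, hyx⟩ := exists_slitMap_inv_eq ha haT hx
    refine ⟨I * y, ⟨by simp [hpi.le], ?_⟩, fun hc => by simpa using hc.1.1, fun h => hx0 ?_, ?_⟩
    · simpa using ⟨hy.1, by linarith [hy.2]⟩
    · rw [slitMap, h, div_zero, inv_zero] at hyx
      exact_mod_cast hyx.symm
    · rw [← hyx, inv_inv]
  rcases hw with ((⟨φ, hφ, rfl⟩ | ⟨φ, hφ, rfl⟩) | ⟨x, rfl, hx⟩) | ⟨x, rfl, hx⟩
  · obtain ⟨x, hx, hx'⟩ := (hγ _).mpr ⟨φ, hφ, rfl⟩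
    refine ⟨x, ⟨by simpa using hx, by simpa using hT.le⟩, fun hc => by simpa using hc.2.1,
      den_ne_zero_of_im ha haT ?_ ?_ ?_, hx'⟩
    · simp
    · simp [hT.le]
    · simp; linarith
  · obtain ⟨x, hx, hx'⟩ := (hγ _).mpr ⟨φ, hφ, rfl⟩
    refine ⟨x + I * T, ⟨by simpa using hx, by simpa using hT.le⟩, fun hc => by simpa using hc.2.2,
      den_ne_zero_of_im ha haT ?_ ?_ ?_, ?_⟩
    · simp [hT.le]
    · simp
    · simp; linarith
    · rw [slitMap_add_I_mul hT, hx']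
      field_simp
  · have hx0 : 0 < x := by linarith
    have h := hlow x⁻¹ ⟨by linarith [inv_pos.mpr hx0], inv_anti₀ (by linarith) hx⟩ (inv_ne_zero hx0.ne')
    simpa using h
  · rcases lt_or_ge x (-1) with h | h
    · have h1 := hlow x⁻¹ ⟨?_, ?_⟩ (inv_ne_zero (by linarith))
      · simpa using h1
      · rw [← neg_le_neg_iff, neg_neg, ← inv_neg]
        exact inv_le_one_of_one_le₀ (by linarith)
      · exact (inv_nonpos.mpr (by linarith)).trans (inv_pos.mpr (by linarith)).le
    · obtain ⟨y, hy, hyx⟩ := exists_slitMap_inv_eq ha haT ⟨h, by rwa [one_div] at hx⟩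
      refine ⟨conj (I * y) + I * T, ⟨by simp [hpi.le], ?_⟩, fun hc => by simpa using hc.1.1,
        den_ne_zero_of_im ha haT ?_ ?_ ?_, ?_⟩
      · simp
        constructor <;> linarith [hy.1, hy.2]
      · simp; linarith [hy.2]
      · simp; linarith [hy.1]
      · simp; linarith [hy.2]
      · rw [slitMap_conj_add_I_mul hT, ← map_inv₀, hyx, conj_ofReal]

end Boundary

/-! ### The image of the rectangle -/

section Image

open Complex Filter Topology Set ComplexConjugate

lemma convex_reProdIm {s t : Set ℝ} (hs : Convex ℝ s) (ht : Convex ℝ t) : Convex ℝ (s ×ℂ t) :=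
  (hs.linear_preimage reLm).inter (ht.linear_preimage imLm)

/-- The logarithm of the complement of `slitSet (exp l) γ`. -/
def logSlitDomain (l γ : ℝ) : Set ℂ :=
  Ioo (-l) l ×ℂ Ioo (-π) π ∪ univ ×ℂ Ioo γ π ∪ univ ×ℂ Ioo (-π) (-γ) ∪ Ioi l ×ℂ Ioo 0 π ∪
    Iio (-l) ×ℂ Ioo 0 π ∪ Ioi l ×ℂ Ioo (-π) 0 ∪ Iio (-l) ×ℂ Ioo (-π) 0

lemma isPreconnected_logSlitDomain {l γ : ℝ} (hl : 0 < l) (h0 : 0 < γ) (h1 : γ < π) :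
    IsPreconnected (logSlitDomain l γ) := by
  have hpre : ∀ {s t : Set ℝ}, Convex ℝ s → Convex ℝ t → IsPreconnected (s ×ℂ t) :=
    fun hs ht => (convex_reProdIm hs ht).isPreconnected
  have hm : ∀ x y : ℝ, ∀ s t : Set ℝ, x ∈ s → y ∈ t → (⟨x, y⟩ : ℂ) ∈ s ×ℂ t :=
    fun _ _ _ _ hx hy => ⟨hx, hy⟩
  have hu : (γ + π) / 2 ∈ Ioo γ π := ⟨by linarith, by linarith⟩
  have hd : -((γ + π) / 2) ∈ Ioo (-π) (-γ) := ⟨by linarith, by linarith⟩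
  have hu0 : (γ + π) / 2 ∈ Ioo 0 π := ⟨by linarith, by linarith⟩
  have hd0 : -((γ + π) / 2) ∈ Ioo (-π) 0 := ⟨by linarith, by linarith⟩
  have hz : (0 : ℝ) ∈ Ioo (-l) l := ⟨by linarith, hl⟩
  have huπ : (γ + π) / 2 ∈ Ioo (-π) π := ⟨by linarith, by linarith⟩
  have hdπ : -((γ + π) / 2) ∈ Ioo (-π) π := ⟨by linarith, by linarith⟩
  have hr : l + 1 ∈ Ioi l := by simp
  have hr' : -l - 1 ∈ Iio (-l) := by simp
  have h2 := IsPreconnected.union (⟨0, (γ + π) / 2⟩ : ℂ)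
    (hm _ _ _ _ hz huπ) (hm _ _ _ _ (mem_univ _) hu)
    (hpre (convex_Ioo (-l) l) (convex_Ioo (-π) π)) (hpre convex_univ (convex_Ioo γ π))
  have h3 := h2.union (⟨0, -((γ + π) / 2)⟩ : ℂ)
    (Or.inl (hm _ _ _ _ hz hdπ)) (hm _ _ _ _ (mem_univ _) hd)
    (hpre convex_univ (convex_Ioo (-π) (-γ)))
  have h4 := h3.union (⟨l + 1, (γ + π) / 2⟩ : ℂ)
    (Or.inl (Or.inr (hm _ _ _ _ (mem_univ _) hu))) (hm _ _ _ _ hr hu0)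
    (hpre (convex_Ioi l) (convex_Ioo 0 π))
  have h5 := h4.union (⟨-l - 1, (γ + π) / 2⟩ : ℂ)
    (Or.inl (Or.inl (Or.inr (hm _ _ _ _ (mem_univ _) hu)))) (hm _ _ _ _ hr' hu0)
    (hpre (convex_Iio (-l)) (convex_Ioo 0 π))
  have h6 := h5.union (⟨l + 1, -((γ + π) / 2)⟩ : ℂ)
    (Or.inl (Or.inl (Or.inr (hm _ _ _ _ (mem_univ _) hd)))) (hm _ _ _ _ hr hd0)
    (hpre (convex_Ioi l) (convex_Ioo (-π) 0))
  exact h6.union (⟨-l - 1, -((γ + π) / 2)⟩ : ℂ)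
    (Or.inl (Or.inl (Or.inl (Or.inr (hm _ _ _ _ (mem_univ _) hd))))) (hm _ _ _ _ hr' hd0)
    (hpre (convex_Iio (-l)) (convex_Ioo (-π) 0))

lemma mem_logSlitDomain_iff {l γ : ℝ} (hl : 0 < l) (h0 : 0 < γ) (h1 : γ < π) {z : ℂ} :
    z ∈ logSlitDomain l γ ↔ |z.im| < π ∧ (z.im = 0 → |z.re| < l) ∧ (|z.re| = l → γ < |z.im|) := by
  simp only [logSlitDomain, mem_union, mem_reProdIm, mem_Ioo, mem_Ioi, mem_Iio, mem_univ, true_and]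
  rcases abs_cases z.re with ⟨hx, hx'⟩ | ⟨hx, hx'⟩ <;>
  rcases abs_cases z.im with ⟨hy, hy'⟩ | ⟨hy, hy'⟩ <;>
  rw [hx, hy] <;> clear hx hy <;> generalize z.re = x at * <;> generalize z.im = y at * <;> grind

lemma exp_image_logSlitDomain {l γ : ℝ} (hl : 0 < l) (h0 : 0 < γ) (h1 : γ < π) :
    exp '' logSlitDomain l γ = (slitSet (Real.exp l) γ)ᶜ := by
  have hpi := Real.pi_pos
  have harc : ∀ {z : ℂ} {r φ : ℝ}, |z.im| < π → |φ| ≤ γ →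
      exp z = (Real.exp r : ℂ) * exp (I * φ) → z.re = r ∧ |z.im| ≤ γ := fun {z r φ} hz hφ h => by
    have h2 := congrArg Complex.log h
    obtain ⟨hz1, hz2⟩ := abs_lt.mp hz
    obtain ⟨hφ1, hφ2⟩ := abs_le.mp hφ
    rw [log_exp hz1 hz2.le, ofReal_exp, ← exp_add, log_exp (by simp; linarith)
      (by simp; linarith)] at h2
    rw [h2]
    simpa using hφ
  have hreal : ∀ {z : ℂ} {x : ℝ}, |z.im| < π → exp z = x → z.im = 0 ∧ x = Real.exp z.re :=
    fun {z x} hz h => by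
    obtain ⟨hz1, hz2⟩ := abs_lt.mp hz
    have him := congrArg im h
    rw [exp_im, ofReal_im, mul_eq_zero, or_iff_right (Real.exp_pos _).ne',
      Real.sin_eq_zero_iff_of_lt_of_lt hz1 hz2] at him
    have hre := congrArg re h
    rw [exp_re, him, Real.cos_zero, mul_one, ofReal_re] at hre
    exact ⟨him, hre.symm⟩
  ext w
  simp only [mem_image, mem_logSlitDomain_iff hl h0 h1]
  constructor
  · rintro ⟨z, ⟨hz1, hz2, hz3⟩, rfl⟩
    rintro (((⟨φ, hφ, h⟩ | ⟨φ, hφ, h⟩) | ⟨x, h, hx⟩) | ⟨x, h, hx⟩)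
    · obtain ⟨h4, h5⟩ := harc hz1 hφ h
      exact absurd (hz3 (by rw [h4, abs_of_pos hl])) (not_lt.mpr h5)
    · obtain ⟨h4, h5⟩ := harc (r := -l) hz1 hφ (by rw [h, Real.exp_neg, ofReal_inv])
      exact absurd (hz3 (by rw [h4, abs_neg, abs_of_pos hl])) (not_lt.mpr h5)
    · obtain ⟨h4, h5⟩ := hreal hz1 h
      rw [h5, Real.exp_le_exp] at hx
      exact (hx.trans (le_abs_self _)).not_gt (hz2 h4)
    · obtain ⟨h4, h5⟩ := hreal hz1 h
      rw [h5, one_div, ← Real.exp_neg, Real.exp_le_exp] at hx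
      exact (le_neg.mp hx |>.trans (neg_le_abs _)).not_gt (hz2 h4)
  · intro hw
    have hpos : 0 < 1 / Real.exp l := by positivity
    have hw0 : w ≠ 0 := fun h => hw (Or.inr ⟨0, by simpa using h, hpos.le⟩)
    have hnorm := norm_pos_iff.mpr hw0
    have hpolar := norm_mul_exp_arg_mul_I w
    refine ⟨log w, ⟨?_, ?_, ?_⟩, exp_log hw0⟩
    · rw [log_im]
      refine (abs_arg_le_pi w).lt_of_ne fun h => ?_
      have harg : arg w = π := by
        rcases (abs_eq hpi.le).mp h with h | h
        · exact h
        · exact absurd h (neg_pi_lt_arg w).ne'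
      obtain ⟨hre, him⟩ := arg_eq_pi_iff.mp harg
      exact hw (Or.inr ⟨w.re, Complex.ext rfl him, hre.le.trans hpos.le⟩)
    · intro h
      rw [log_im] at h
      rw [h, ofReal_zero, zero_mul, exp_zero, mul_one] at hpolar
      rw [log_re, abs_lt]
      refine ⟨not_le.mp fun h => hw (Or.inr ⟨‖w‖, hpolar.symm, ?_⟩),
        not_le.mp fun h => hw (Or.inl (Or.inr ⟨‖w‖, hpolar.symm, ?_⟩))⟩
      · rwa [one_div, ← Real.exp_neg, ← Real.log_le_iff_le_exp hnorm]
      · rwa [← Real.le_log_iff_exp_le hnorm]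
    · intro h
      rw [log_im]
      rw [log_re, abs_eq hl.le] at h
      refine not_le.mp fun h' => hw (Or.inl (Or.inl ?_))
      rcases h with h | h
      · refine Or.inl ⟨arg w, h', ?_⟩
        rw [← h, Real.exp_log hnorm, mul_comm I, hpolar]
      · refine Or.inr ⟨arg w, h', ?_⟩
        rw [← ofReal_inv, ← Real.exp_neg, ← h, Real.exp_log hnorm, mul_comm I, hpolar]

variable {T a : ℝ}

lemma image_slitMap (ha : 0 < a) (haT : 2 * a < T) :
    ∃ γ : ℝ, 0 < γ ∧ γ < π ∧
      slitMap T a '' (Ioo 0 π ×ℂ Ioo 0 T) = (slitSet (Real.exp (2 * a)) γ)ᶜ := by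
  have hT : 0 < T := by linarith
  have hpi := Real.pi_pos
  obtain ⟨γ, h0, h1, hγ⟩ := exists_arc_slitMap ha haT
  refine ⟨γ, h0, h1, ?_⟩
  have hsub : slitMap T a '' (Ioo 0 π ×ℂ Ioo 0 T) ⊆ (slitSet (Real.exp (2 * a)) γ)ᶜ := by
    rintro _ ⟨v, hv, rfl⟩ hmem
    obtain ⟨b, hb, hb', hden, h⟩ := exists_boundary_slitMap_eq ha haT hγ hmem
    exact slitMap_ne_of_mem_boundary ha haT hb hb' hden hv h
  refine hsub.antisymm ?_
  have hconn : IsPreconnected (slitSet (Real.exp (2 * a)) γ)ᶜ := by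
    rw [← exp_image_logSlitDomain (by linarith) h0 h1]
    exact (isPreconnected_logSlitDomain (by linarith) h0 h1).image _ continuous_exp.continuousOn
  refine hconn.subset_of_closure_inter_subset
    (isOpen_image_slitMap ha hT (isOpen_Ioo.reProdIm isOpen_Ioo) fun v hv => hv.1) ?_ ?_
  · have hv : (⟨π / 2, T / 2⟩ : ℂ) ∈ Ioo 0 π ×ℂ Ioo 0 T :=
      ⟨⟨by positivity, by simp; linarith⟩, by positivity, by simp; linarith⟩
    exact ⟨_, hsub (mem_image_of_mem _ hv), mem_image_of_mem _ hv⟩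
  · rintro w ⟨hw, hwB⟩
    obtain ⟨x, hx, hxw⟩ := mem_closure_iff_seq_limit.mp hw
    choose v hvQ hv using hx
    obtain ⟨b, hb, φ, hφ, hlim⟩ := (isCompact_Icc.reProdIm isCompact_Icc).tendsto_subseq
      (s := Icc 0 π ×ℂ Icc 0 T)
      fun n => ⟨Ioo_subset_Icc_self (hvQ n).1, Ioo_subset_Icc_self (hvQ n).2⟩
    have hθ := (differentiable_thetaFour hT).continuous
    have hnum : Tendsto (fun n => (Real.exp (2 * a) : ℂ) * thetaFour T (v (φ n) - I * a)) atTop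
        (𝓝 ((Real.exp (2 * a) : ℂ) * thetaFour T (b - I * a))) :=
      ((hθ.tendsto _).comp (hlim.sub_const _)).const_mul _
    have hdenom : Tendsto (fun n => thetaFour T (v (φ n) + I * a)) atTop
        (𝓝 (thetaFour T (b + I * a))) := (hθ.tendsto _).comp (hlim.add_const _)
    have hprod : Tendsto (fun n => x (φ n) * thetaFour T (v (φ n) + I * a)) atTop
        (𝓝 (w * thetaFour T (b + I * a))) := (hxw.comp hφ.tendsto_atTop).mul hdenom
    have heq : w * thetaFour T (b + I * a) = (Real.exp (2 * a) : ℂ) * thetaFour T (b - I * a) := by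
      refine tendsto_nhds_unique hprod (hnum.congr fun n => ?_)
      rw [← hv, slitMap, div_mul_cancel₀ _ (den_ne_zero_of_re hT (hvQ _).1.1 (hvQ _).1.2)]
    have hden : thetaFour T (b + I * a) ≠ 0 := fun h => by
      have him : b.im = T / 2 - a := by
        by_contra hc
        exact den_ne_zero_of_im ha haT hb.2.1 hb.2.2 hc h
      rw [h, mul_zero] at heq
      rcases mul_eq_zero.mp heq.symm with h | h
      · exact ofReal_ne_zero.mpr (Real.exp_pos _).ne' h
      · exact num_ne_zero_of_im ha haT hb.2.1 hb.2.2 (by linarith) h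
    have hwb : slitMap T a b = w := by rw [slitMap, ← heq, mul_div_cancel_right₀ _ hden]
    by_cases hbQ : b ∈ Ioo 0 π ×ℂ Ioo 0 T
    · exact ⟨b, hbQ, hwb⟩
    · exact absurd (hwb ▸ slitMap_mem_slitSet ha haT hγ hb hbQ) hwB

lemma zmap_eq_slitMap (ω₁ R T : ℝ) (hR : 0 < R) (u : ℂ) :
    zmap ω₁ R (Real.exp (-T)) u = slitMap T (Real.log R / 2) ((π / ω₁ : ℝ) * u) := by
  have h1 : 2 * (Real.log R / 2) = Real.log R := by ring
  rw [zmap, slitMap, h1, Real.exp_log hR, thetaFour, thetaFour]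
  push_cast
  ring_nf

end Image

/-- The map z(u) is conformal and univalent on the rectangle (0,ω₁) × (0,ω₂) and maps it
onto the plane with two circular slits of radii R and 1/R symmetric with respect to the
real axis, connected by a slit along the real axis going through infinity. -/
theorem zmap_conformal_rectangle (ω₁ ω₂ R : ℝ) (hω₁ : 0 < ω₁) (hω₂ : 0 < ω₂)
    (hR : 1 < R) (hR2 : R < Real.exp (π * ω₂ / ω₁)) (q : ℝ)
    (hq : q = Real.exp (-(π * ω₂ / ω₁))) :
    DifferentiableOn ℂ (zmap ω₁ R q)
        {u : ℂ | 0 < u.re ∧ u.re < ω₁ ∧ 0 < u.im ∧ u.im < ω₂} ∧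
    Set.InjOn (zmap ω₁ R q) {u : ℂ | 0 < u.re ∧ u.re < ω₁ ∧ 0 < u.im ∧ u.im < ω₂} ∧
    ∃ γ : ℝ, 0 < γ ∧ γ < π ∧
      zmap ω₁ R q '' {u : ℂ | 0 < u.re ∧ u.re < ω₁ ∧ 0 < u.im ∧ u.im < ω₂} =
        Set.univ \
          ({w : ℂ | ∃ φ : ℝ, |φ| ≤ γ ∧ w = (R : ℂ) * Complex.exp (Complex.I * (φ : ℂ))} ∪
           {w : ℂ | ∃ φ : ℝ, |φ| ≤ γ ∧ w = (R : ℂ)⁻¹ * Complex.exp (Complex.I * (φ : ℂ))} ∪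
           {w : ℂ | ∃ x : ℝ, w = (x : ℂ) ∧ R ≤ x} ∪
           {w : ℂ | ∃ x : ℝ, w = (x : ℂ) ∧ x ≤ 1 / R}) := by
  have hpi := Real.pi_pos
  set T := π * ω₂ / ω₁ with hTdef
  have hR0 : 0 < R := by linarith
  have ha : 0 < Real.log R / 2 := half_pos (Real.log_pos hR)
  have haT : 2 * (Real.log R / 2) < T := by
    rwa [mul_div_cancel₀ _ two_ne_zero, Real.log_lt_iff_lt_exp hR0]
  have hT : 0 < T := by linarith
  have hc : 0 < π / ω₁ := by positivity
  have hz : zmap ω₁ R q = slitMap T (Real.log R / 2) ∘ fun u => ((π / ω₁ : ℝ) : ℂ) * u :=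
    funext fun u => by rw [hq, zmap_eq_slitMap ω₁ R T hR0]; rfl
  have hmem : ∀ u : ℂ, u ∈ {u : ℂ | 0 < u.re ∧ u.re < ω₁ ∧ 0 < u.im ∧ u.im < ω₂} ↔
      ((π / ω₁ : ℝ) : ℂ) * u ∈ Set.Ioo 0 π ×ℂ Set.Ioo 0 T := fun u => by
    have h1 : π / ω₁ * u.re < π ↔ u.re < ω₁ := by
      rw [div_mul_eq_mul_div, div_lt_iff₀ hω₁, mul_lt_mul_iff_right₀ hpi]
    have h2 : π / ω₁ * u.im < T ↔ u.im < ω₂ := by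
      rw [hTdef, div_mul_eq_mul_div, div_lt_div_iff_of_pos_right hω₁, mul_lt_mul_iff_right₀ hpi]
    simp only [Set.mem_ofPred_eq, Complex.mem_reProdIm, Complex.re_ofReal_mul,
      Complex.im_ofReal_mul, Set.mem_Ioo, mul_pos_iff_of_pos_left hc, h1, h2, and_assoc]
  have hc' : ((π / ω₁ : ℝ) : ℂ) ≠ 0 := Complex.ofReal_ne_zero.mpr hc.ne'
  refine ⟨fun u hu => ?_, ?_, ?_⟩
  · have hu' := (hmem u).mp hu
    rw [hz]
    exact ((differentiableAt_slitMap hT (den_ne_zero_of_re hT hu'.1.1 hu'.1.2)).comp u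
      (differentiableAt_id.const_mul _)).differentiableWithinAt
  · rw [hz]
    exact (injOn_slitMap ha haT).comp (mul_right_injective₀ hc').injOn fun u hu => (hmem u).mp hu
  · obtain ⟨γ, h0, h1, h⟩ := image_slitMap ha haT
    refine ⟨γ, h0, h1, ?_⟩
    have himage : (fun u => ((π / ω₁ : ℝ) : ℂ) * u) ''
        {u : ℂ | 0 < u.re ∧ u.re < ω₁ ∧ 0 < u.im ∧ u.im < ω₂} = Set.Ioo 0 π ×ℂ Set.Ioo 0 T := by
      ext v
      refine ⟨fun ⟨u, hu, huv⟩ => huv ▸ (hmem u).mp hu, fun hv => ⟨v / ((π / ω₁ : ℝ) : ℂ), ?_, ?_⟩⟩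
      · rwa [hmem, mul_div_cancel₀ _ hc']
      · exact mul_div_cancel₀ _ hc'
    rw [hz, Set.image_comp, himage, h, mul_div_cancel₀ _ two_ne_zero, Real.exp_log hR0,
      Set.compl_eq_univ_sdiff]
    rfl
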